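/- There exist an uncountable index set Λ and a family {(X_λ, φ_λ) : λ ∈ Λ} such that: for each λ ∈ Λ, X_λ is a Lelek-like fan; for each λ ∈ Λ, φ_λ : X_λ → X_λ is a homeomorphism and the dynamical system (X_λ, φ_λ) is topologically mixing; and for all λ₁, λ₂ ∈ Λ with λ₁ ≠ λ₂, the spaces X_{λ₁} and X_{λ₂} are not homeomorphic. -/

import Mathlib

open Set Filter Topology

/-- A set `A` is an arc if it is homeomorphic to the closed unit interval `[0,1]`. -/
def IsArc {X : Type} [TopologicalSpace X] (A : Set X) : Prop :=
  Nonempty (↥(Set.Icc (0:ℝ) 1) ≃ₜ ↥A)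

/-- `x` is an end-point of the arc `A`: some homeomorphism `[0,1] ≃ₜ A` sends `0` to `x`. -/
def IsArcEndpoint {X : Type} [TopologicalSpace X] (A : Set X) (x : X) : Prop :=
  ∃ e : ↥(Set.Icc (0:ℝ) 1) ≃ₜ ↥A, ((e ⟨0, le_refl 0, zero_le_one⟩ : A) : X) = x

/-- A subcontinuum: a nonempty compact connected subset. -/
def IsSubcontinuum {X : Type} [TopologicalSpace X] (A : Set X) : Prop :=
  IsCompact A ∧ IsConnected A

/-- Every subcontinuum `C` is unicoherent: whenever `C = A ∪ B` with `A`, `B`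
subcontinua, the intersection `A ∩ B` is connected. -/
def HereditarilyUnicoherent (X : Type) [TopologicalSpace X] : Prop :=
  ∀ C A B : Set X, IsSubcontinuum C → IsSubcontinuum A → IsSubcontinuum B →
    A ∪ B = C → IsConnected (A ∩ B)

/-- A dendroid: an arcwise connected, hereditarily unicoherent (metrizable) continuum. -/
def IsDendroid (X : Type) [TopologicalSpace X] : Prop :=
  Nonempty X ∧ CompactSpace X ∧ ConnectedSpace X ∧ TopologicalSpace.MetrizableSpace X ∧
  (∀ x y : X, x ≠ y → ∃ A : Set X, IsArcEndpoint A x ∧ IsArcEndpoint A y) ∧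
  HereditarilyUnicoherent X

/-- The set of end-points of a dendroid: points which are end-points of every arc
containing them. -/
def DendroidEndpoints (X : Type) [TopologicalSpace X] : Set X :=
  {x | ∀ A : Set X, IsArc A → x ∈ A → IsArcEndpoint A x}

/-- The model simple triode `([-1,1] × {0}) ∪ ({0} × [0,1]) ⊆ ℝ²`. -/
def TSet : Set (ℝ × ℝ) := (Set.Icc (-1:ℝ) 1 ×ˢ ({0} : Set ℝ)) ∪ (({0} : Set ℝ) ×ˢ Set.Icc (0:ℝ) 1)

lemma zero_mem_TSet : ((0:ℝ), (0:ℝ)) ∈ TSet :=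
  Or.inl ⟨⟨by norm_num, by norm_num⟩, rfl⟩

/-- `T` is a simple triode with top `x`: some homeomorphism from the model triode onto `T`
sends `(0,0)` to `x`. -/
def IsSimpleTriodeWithTop {X : Type} [TopologicalSpace X] (T : Set X) (x : X) : Prop :=
  ∃ e : ↥TSet ≃ₜ ↥T, ((e ⟨((0:ℝ), (0:ℝ)), zero_mem_TSet⟩ : T) : X) = x

/-- `x` is a ramification point: the top of some simple triode contained in the space. -/
def IsRamificationPoint {X : Type} [TopologicalSpace X] (x : X) : Prop :=
  ∃ T : Set X, IsSimpleTriodeWithTop T x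

/-- A fan: a dendroid with at most one ramification point. -/
def IsFan (X : Type) [TopologicalSpace X] : Prop :=
  IsDendroid X ∧ ∀ x y : X, IsRamificationPoint x → IsRamificationPoint y → x = y

/-- `v` is the top of the fan: its ramification point if one exists, otherwise an end-point. -/
def IsFanTop {X : Type} [TopologicalSpace X] (v : X) : Prop :=
  IsRamificationPoint v ∨
    ((∀ x : X, ¬ IsRamificationPoint x) ∧ v ∈ DendroidEndpoints X)

/-- A Lelek-like fan: a fan whose set of end-points is dense. -/
def IsLelekLikeFan (X : Type) [TopologicalSpace X] : Prop :=
  IsFan X ∧ Dense (DendroidEndpoints X)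
/-- A dynamical system is topologically mixing if for all nonempty open sets `U`, `V`
there is `n₀` such that `f^[n] '' U` meets `V` for every `n ≥ n₀`. -/
def TopologicallyMixing {X : Type} [TopologicalSpace X] (f : X → X) : Prop :=
  ∀ U V : Set X, IsOpen U → IsOpen V → U.Nonempty → V.Nonempty →
    ∃ n₀ : ℕ, ∀ n : ℕ, n₀ ≤ n → (f^[n] '' U ∩ V).Nonempty

/-- A dynamical system is (topologically) transitive if for all nonempty open sets `U`, `V`
there is `n ≥ 0` such that `f^[n] '' U` meets `V`. -/
def TopologicallyTransitive {X : Type} [TopologicalSpace X] (f : X → X) : Prop :=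
  ∀ U V : Set X, IsOpen U → IsOpen V → U.Nonempty → V.Nonempty →
    ∃ n : ℕ, (f^[n] '' U ∩ V).Nonempty

lemma exists_homeo_of_coord {X : Type} [TopologicalSpace X] {A : Set X} (hA : IsCompact A)
    {G : X → ℝ} (hG : ContinuousOn G A) (hinj : InjOn G A) {a b : ℝ}
    (him : G '' A = Icc a b) : ∃ e : ↥A ≃ₜ ↥(Icc a b), ∀ x, (e x : ℝ) = G x := by
  have : CompactSpace A := isCompact_iff_compactSpace.mp hA
  have hb : BijOn G A (Icc a b) := ⟨fun x hx => him ▸ mem_image_of_mem G hx, hinj, him.ge⟩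
  have hc : Continuous (hb.equiv G) :=
    Continuous.subtype_mk (continuousOn_iff_continuous_domRestrict.mp hG) _
  exact ⟨hc.homeoOfEquivCompactToT2, fun x => rfl⟩

lemma isPreconnected_of_coord {X : Type} [TopologicalSpace X] {A : Set X} (hA : IsCompact A)
    {G : X → ℝ} (hG : ContinuousOn G A) (hinj : InjOn G A) {a b : ℝ}
    (him : G '' A = Icc a b) : IsPreconnected A := by
  obtain ⟨e, -⟩ := exists_homeo_of_coord hA hG hinj him
  rw [isPreconnected_iff_preconnectedSpace]
  have : PreconnectedSpace (Icc a b) :=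
    isPreconnected_iff_preconnectedSpace.mp isPreconnected_Icc
  exact e.symm.surjective.denseRange.preconnectedSpace e.symm.continuous

/-- The order-reversing involution of the unit interval as a homeomorphism. -/
noncomputable def iccReverse : ↥(Icc (0:ℝ) 1) ≃ₜ ↥(Icc (0:ℝ) 1) := unitInterval.symmHomeomorph

lemma isArcEndpoint_reverse {X : Type} [TopologicalSpace X] {A : Set X}
    (e : ↥(Icc (0:ℝ) 1) ≃ₜ ↥A) :
    IsArcEndpoint A ((e ⟨1, zero_le_one, le_refl 1⟩ : A) : X) := by
  refine ⟨iccReverse.trans e, ?_⟩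
  have : iccReverse ⟨0, le_refl 0, zero_le_one⟩ = ⟨1, zero_le_one, le_refl 1⟩ := by
    apply Subtype.ext
    change (1:ℝ) - 0 = 1
    norm_num
  simp [this]

lemma isArcEndpoint_of_coord {X : Type} [TopologicalSpace X] {A : Set X} (hA : IsCompact A)
    {G : X → ℝ} (hG : ContinuousOn G A) (hinj : InjOn G A) {a b : ℝ} (hab : a < b)
    (him : G '' A = Icc a b) {x : X} (hx : x ∈ A) (h : G x = a ∨ G x = b) :
    IsArcEndpoint A x := by
  obtain ⟨e, he⟩ := exists_homeo_of_coord hA hG hinj him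
  have key : ∀ y : A, G y = G x → (y : X) = x := fun y hy => hinj y.2 hx hy
  let E := (iccHomeoI a b hab).symm.trans e.symm
  rcases h with h | h
  · refine ⟨E, key _ ?_⟩
    rw [← he]
    simp [E, h]
  · have := isArcEndpoint_reverse E
    convert this
    refine (key _ ?_).symm
    rw [← he]
    simp [E, h]

/-- A description of a compact space as a union of arcs (legs) issuing from a common point, where
the legs are parametrized by a totally disconnected space and each leg has a global coordinate. -/
structure FanChart (X P : Type) [TopologicalSpace X] [TopologicalSpace P] where
  v : X
  leg : X → P
  ht : P → X → ℝ
  leg_cont : ContinuousOn leg {v}ᶜ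
  ht_cont : ∀ s, Continuous (ht s)
  ht_top : ∀ s, ht s v = 0
  ht_pos : ∀ x, x ≠ v → 0 < ht (leg x) x
  ht_inj : ∀ x y, x ≠ v → y ≠ v → leg x = leg y → ht (leg x) x = ht (leg x) y → x = y
  ht_surj : ∀ x, x ≠ v → ∀ r, 0 < r → r ≤ ht (leg x) x →
    ∃ y, y ≠ v ∧ leg y = leg x ∧ ht (leg x) y = r

set_option linter.unusedSectionVars false

namespace FanChart

variable {X P : Type} [TopologicalSpace X] [TopologicalSpace P] [CompactSpace X] [T2Space X]
  [CompactSpace P] [T2Space P] [TotallyDisconnectedSpace P] (c : FanChart X P)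

/-- The closed leg with label `s`, including the top. -/
def legSet (s : P) : Set X := {w | w = c.v ∨ leg c w = s}

/-- The part of the leg `s` with heights between `a` and `b`. -/
def part (s : P) (a b : ℝ) : Set X := c.legSet s ∩ {w | a ≤ c.ht s w ∧ c.ht s w ≤ b}

/-- The order of the fan: `x` lies on the arc from the top to `y`. -/
def le (x y : X) : Prop :=
  x = c.v ∨ (x ≠ c.v ∧ y ≠ c.v ∧ c.leg x = c.leg y ∧ c.ht (c.leg y) x ≤ c.ht (c.leg y) y)

lemma isOpen_leg {U : Set P} (hU : IsOpen U) : IsOpen {w | w ≠ c.v ∧ c.leg w ∈ U} :=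
  c.leg_cont.isOpen_inter_preimage isOpen_compl_singleton hU

lemma isClosed_legSet (s : P) : IsClosed (c.legSet s) := by
  have := (c.isOpen_leg (isOpen_compl_singleton (x := s))).isClosed_compl
  convert this using 1
  ext w
  simp only [legSet, mem_ofPred_eq, mem_compl_iff, mem_singleton_iff]
  tauto

lemma isCompact_part (s : P) (a b : ℝ) : IsCompact (c.part s a b) :=
  ((c.isClosed_legSet s).inter ((isClosed_le continuous_const (c.ht_cont s)).inter
    (isClosed_le (c.ht_cont s) continuous_const))).isCompact

lemma ht_nonneg {s : P} {w : X} (hw : w ∈ c.legSet s) : 0 ≤ c.ht s w := by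
  by_cases h : w = c.v
  · rw [h, c.ht_top]
  · rcases hw with hw | hw
    · exact absurd hw h
    · subst hw; exact (c.ht_pos w h).le

lemma injOn_legSet (s : P) : InjOn (c.ht s) (c.legSet s) := by
  intro x hx y hy h
  by_cases hxv : x = c.v <;> by_cases hyv : y = c.v
  · rw [hxv, hyv]
  · rcases hy with hy | hy
    · exact absurd hy hyv
    · subst hy
      have := c.ht_pos y hyv
      rw [← h, hxv, c.ht_top] at this
      exact absurd this (lt_irrefl _)
  · rcases hx with hx | hx
    · exact absurd hx hxv
    · subst hx
      have := c.ht_pos x hxv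
      rw [h, hyv, c.ht_top] at this
      exact absurd this (lt_irrefl _)
  · rcases hx with hx | hx
    · exact absurd hx hxv
    rcases hy with hy | hy
    · exact absurd hy hyv
    subst hx
    exact c.ht_inj x y hxv hyv hy.symm h

lemma image_part {y : X} (hy : y ≠ c.v) {a : ℝ} (ha : 0 ≤ a) :
    c.ht (c.leg y) '' c.part (c.leg y) a (c.ht (c.leg y) y)
      = Icc a (c.ht (c.leg y) y) := by
  apply Subset.antisymm
  · rintro _ ⟨w, hw, rfl⟩
    exact hw.2
  · intro r hr
    rcases eq_or_lt_of_le (ha.trans hr.1) with h | h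
    · refine ⟨c.v, ⟨Or.inl rfl, ?_⟩, ?_⟩
      · simp only [mem_ofPred_eq, c.ht_top]
        exact ⟨h ▸ hr.1, (c.ht_pos y hy).le⟩
      · rw [c.ht_top]; exact h
    · obtain ⟨w, hw, h1, h2⟩ := c.ht_surj y hy r h hr.2
      exact ⟨w, ⟨Or.inr h1, by simp only [mem_ofPred_eq, h2]; exact hr⟩, h2⟩

lemma isPreconnected_part {y : X} (hy : y ≠ c.v) {a : ℝ} (ha : 0 ≤ a) :
    IsPreconnected (c.part (c.leg y) a (c.ht (c.leg y) y)) :=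
  isPreconnected_of_coord (c.isCompact_part _ _ _) (c.ht_cont _).continuousOn
    ((c.injOn_legSet _).mono inter_subset_left) (c.image_part hy ha)

lemma leg_eq_of_isPreconnected {C : Set X} (hC : IsPreconnected C) (hv : c.v ∉ C) {x y : X}
    (hx : x ∈ C) (hy : y ∈ C) : c.leg x = c.leg y := by
  have h : C ⊆ {c.v}ᶜ := fun z hz hz' => hv (hz' ▸ hz)
  exact (hC.image c.leg (c.leg_cont.mono h)).subsingleton (mem_image_of_mem _ hx)
    (mem_image_of_mem _ hy)

lemma mem_of_between {C : Set X} (hC : IsPreconnected C) (hv : c.v ∉ C) {x y w : X}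
    (hx : x ∈ C) (hy : y ∈ C) (hw : w ≠ c.v) (hl : c.leg w = c.leg y)
    (h1 : c.ht (c.leg y) x ≤ c.ht (c.leg y) w) (h2 : c.ht (c.leg y) w ≤ c.ht (c.leg y) y) :
    w ∈ C := by
  obtain ⟨z, hz, hzw⟩ := hC.intermediate_value hx hy (c.ht_cont (c.leg y)).continuousOn ⟨h1, h2⟩
  have hzv : z ≠ c.v := fun h => hv (h ▸ hz)
  have hzl := c.leg_eq_of_isPreconnected hC hv hz hy
  have : z = w := c.ht_inj z w hzv hw (hzl.trans hl.symm) (by rw [hzl]; exact hzw)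
  exact this ▸ hz

lemma mem_of_below {C : Set X} (hcl : IsClosed C) (hC : IsPreconnected C) (hv : c.v ∈ C) {x y : X}
    (hx : x ∈ C) (hle : c.le y x) : y ∈ C := by
  rcases hle with rfl | ⟨hyv, hxv, hl, hle⟩
  · exact hv
  by_contra hy
  set s := c.leg x with hs
  set r := c.ht s y with hr
  have hr0 : 0 < r := by rw [hr, ← hl]; exact c.ht_pos y hyv
  have hlt : r < c.ht s x := by
    refine lt_of_le_of_ne hle fun h => hy ?_
    have : y = x := c.ht_inj y x hyv hxv hl (by rw [hl]; exact h)
    exact this ▸ hx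
  have hB : IsCompact (C ∩ {w | c.ht s w = r}) :=
    (hcl.inter (isClosed_eq (c.ht_cont s) continuous_const)).isCompact
  have hBv : C ∩ {w | c.ht s w = r} ⊆ {c.v}ᶜ := by
    rintro w ⟨-, hw⟩ h
    rw [mem_singleton_iff.mp h, mem_ofPred_eq, c.ht_top] at hw
    exact hr0.ne hw
  have hK := (hB.image_of_continuousOn (c.leg_cont.mono hBv)).isClosed
  have hsK : s ∈ (c.leg '' (C ∩ {w | c.ht s w = r}))ᶜ := by
    rintro ⟨w, ⟨hwC, hw⟩, hws⟩
    have hwv : w ≠ c.v := hBv ⟨hwC, hw⟩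
    have : w = y := c.ht_inj w y hwv hyv (hws.trans hl.symm) (by rw [hws]; exact hw)
    exact hy (this ▸ hwC)
  obtain ⟨U, hU, hsU, hUK⟩ := compact_exists_isClopen_in_isOpen hK.isOpen_compl hsK
  have ho1 : IsOpen ({w | w ≠ c.v ∧ c.leg w ∈ U} ∩ {w | r < c.ht s w}) :=
    (c.isOpen_leg hU.isOpen).inter (isOpen_lt continuous_const (c.ht_cont s))
  have ho2 : IsOpen ({w | w ≠ c.v ∧ c.leg w ∈ Uᶜ} ∪ {w | c.ht s w < r}) :=
    (c.isOpen_leg hU.compl.isOpen).union (isOpen_lt (c.ht_cont s) continuous_const)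
  obtain ⟨w, -, ⟨⟨-, h1⟩, h2⟩, h3⟩ := hC _ _ ho1 ho2 (by
      intro w hw
      by_cases hwr : c.ht s w < r
      · exact Or.inr (Or.inr hwr)
      have hwv : w ≠ c.v := by
        rintro rfl
        rw [c.ht_top] at hwr
        exact hwr hr0
      by_cases hwU : c.leg w ∈ U
      · refine Or.inl ⟨⟨hwv, hwU⟩, lt_of_le_of_ne (not_lt.mp hwr) fun h => ?_⟩
        exact hUK hwU ⟨w, ⟨hw, h.symm⟩, rfl⟩
      · exact Or.inr (Or.inl ⟨hwv, hwU⟩))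
    ⟨x, hx, ⟨hxv, hsU⟩, hlt⟩ ⟨c.v, hv, Or.inr (by simp only [mem_ofPred_eq, c.ht_top]; exact hr0)⟩
  rcases h3 with h3 | h3
  · exact h3.2 h1
  · exact lt_asymm h2.out h3.out

lemma mem_part_self {y : X} {a : ℝ} (h : a ≤ c.ht (c.leg y) y) :
    y ∈ c.part (c.leg y) a (c.ht (c.leg y) y) := ⟨Or.inr rfl, h, le_refl _⟩

lemma le_of_mem_part {y w : X} (hy : y ≠ c.v) {a : ℝ}
    (hw : w ∈ c.part (c.leg y) a (c.ht (c.leg y) y)) : c.le w y := by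
  by_cases h : w = c.v
  · exact Or.inl h
  · exact Or.inr ⟨h, hy, hw.1.resolve_left h, hw.2.2⟩

/-- The order of a fan is determined by the top and the topology. -/
lemma le_iff (x y : X) :
    c.le x y ↔ ∀ C : Set X, IsClosed C → IsPreconnected C → c.v ∈ C → y ∈ C → x ∈ C := by
  refine ⟨fun h C hcl hC hv hy => c.mem_of_below hcl hC hv hy h, fun h => ?_⟩
  by_cases hy : y = c.v
  · exact Or.inl (h {c.v} isClosed_singleton isPreconnected_singleton rfl hy)
  · refine c.le_of_mem_part hy (a := 0) (h _ (c.isCompact_part _ _ _).isClosed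
      (c.isPreconnected_part hy le_rfl) ⟨Or.inl rfl, ?_⟩ (c.mem_part_self (c.ht_pos y hy).le))
    simp only [mem_ofPred_eq, c.ht_top]
    exact ⟨le_rfl, (c.ht_pos y hy).le⟩

lemma exists_arc_same {x y : X} (hy : y ≠ c.v) (hxy : x ≠ y) (h : c.le x y) :
    ∃ A : Set X, IsArcEndpoint A x ∧ IsArcEndpoint A y := by
  have hx : x ∈ c.legSet (c.leg y) ∧ c.ht (c.leg y) x ≤ c.ht (c.leg y) y := by
    rcases h with rfl | h
    · exact ⟨Or.inl rfl, by rw [c.ht_top]; exact (c.ht_pos y hy).le⟩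
    · exact ⟨Or.inr h.2.2.1, h.2.2.2⟩
  have hlt : c.ht (c.leg y) x < c.ht (c.leg y) y :=
    lt_of_le_of_ne hx.2 fun h => hxy (c.injOn_legSet _ hx.1 (Or.inr rfl) h)
  have h0 := c.ht_nonneg hx.1
  have key := fun z hz h => isArcEndpoint_of_coord (c.isCompact_part _ _ _)
    (c.ht_cont _).continuousOn ((c.injOn_legSet _).mono inter_subset_left) hlt
    (c.image_part hy h0) (x := z) hz h
  exact ⟨_, key x ⟨hx.1, le_rfl, hx.2⟩ (Or.inl rfl), key y (c.mem_part_self hlt.le) (Or.inr rfl)⟩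

lemma exists_arc_different {x y : X} (hx : x ≠ c.v) (hy : y ≠ c.v) (hxy : c.leg x ≠ c.leg y) :
    ∃ A : Set X, IsArcEndpoint A x ∧ IsArcEndpoint A y := by
  classical
  set A := c.part (c.leg x) 0 (c.ht (c.leg x) x) with hA
  set B := c.part (c.leg y) 0 (c.ht (c.leg y) y) with hB
  let G : X → ℝ := fun w => if w ∈ A then - c.ht (c.leg x) w else c.ht (c.leg y) w
  have hAB : ∀ w, w ∈ A → w ∈ B → w = c.v := by
    rintro w ⟨h1, -⟩ ⟨h2, -⟩
    by_contra h
    exact hxy ((h1.resolve_left h).symm.trans (h2.resolve_left h))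
  have hGA : ∀ w ∈ A, G w = - c.ht (c.leg x) w := fun w hw => by simp [G, hw]
  have hGB : ∀ w ∈ B, G w = c.ht (c.leg y) w := fun w hw => by
    by_cases h : w ∈ A
    · rw [hGA w h, hAB w h hw, c.ht_top, c.ht_top, neg_zero]
    · simp [G, h]
  have hxA : x ∈ A := c.mem_part_self (c.ht_pos x hx).le
  have hyB : y ∈ B := c.mem_part_self (c.ht_pos y hy).le
  have hcA := c.isCompact_part (c.leg x) 0 (c.ht (c.leg x) x)
  have hcB := c.isCompact_part (c.leg y) 0 (c.ht (c.leg y) y)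
  have hcont : ContinuousOn G (A ∪ B) :=
    ContinuousOn.union_of_isClosed ((c.ht_cont _).neg.continuousOn.congr hGA)
      ((c.ht_cont _).continuousOn.congr hGB) hcA.isClosed hcB.isClosed
  have hzA : ∀ w ∈ A, c.ht (c.leg x) w = 0 → w = c.v := fun w hw h =>
    c.injOn_legSet (c.leg x) hw.1 (Or.inl rfl) (by rw [h, c.ht_top])
  have hzB : ∀ w ∈ B, c.ht (c.leg y) w = 0 → w = c.v := fun w hw h =>
    c.injOn_legSet (c.leg y) hw.1 (Or.inl rfl) (by rw [h, c.ht_top])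
  have hmix : ∀ w ∈ A, ∀ z ∈ B, G w = G z → w = z := by
    intro w hw z hz h
    rw [hGA w hw, hGB z hz] at h
    have h1 := hw.2.1
    have h2 := hz.2.1
    rw [hzA w hw (by linarith), hzB z hz (by linarith)]
  have hinj : InjOn G (A ∪ B) := by
    rintro w (hw | hw) z (hz | hz) h
    · rw [hGA w hw, hGA z hz] at h
      exact c.injOn_legSet _ hw.1 hz.1 (neg_injective h)
    · exact hmix w hw z hz h
    · exact (hmix z hz w hw h.symm).symm
    · rw [hGB w hw, hGB z hz] at h
      exact c.injOn_legSet _ hw.1 hz.1 h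
  have hpx := c.ht_pos x hx
  have hpy := c.ht_pos y hy
  have him : G '' (A ∪ B) = Icc (-c.ht (c.leg x) x) (c.ht (c.leg y) y) := by
    have e1 : G '' A = Icc (-c.ht (c.leg x) x) 0 := by
      rw [image_congr hGA, ← image_image Neg.neg, c.image_part hx le_rfl]
      simp
    have e2 : G '' B = Icc 0 (c.ht (c.leg y) y) := by
      rw [image_congr hGB, c.image_part hy le_rfl]
    rw [image_union, e1, e2, Icc_union_Icc_eq_Icc (by linarith) hpy.le]
  have key := fun z hz h => isArcEndpoint_of_coord (hcA.union hcB) hcont hinj (by linarith) him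
    (x := z) hz h
  exact ⟨_, key x (Or.inl hxA) (Or.inl (hGA x hxA)), key y (Or.inr hyB) (Or.inr (hGB y hyB))⟩

lemma exists_arc (c : FanChart X P) {x y : X} (hxy : x ≠ y) :
    ∃ A : Set X, IsArcEndpoint A x ∧ IsArcEndpoint A y := by
  by_cases hx : x = c.v
  · exact c.exists_arc_same (fun h => hxy (hx.trans h.symm)) hxy (Or.inl hx)
  by_cases hy : y = c.v
  · obtain ⟨A, h1, h2⟩ := c.exists_arc_same hx hxy.symm (Or.inl hy)
    exact ⟨A, h2, h1⟩
  by_cases hl : c.leg x = c.leg y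
  · rcases le_total (c.ht (c.leg y) x) (c.ht (c.leg y) y) with h | h
    · exact c.exists_arc_same hy hxy (Or.inr ⟨hx, hy, hl, h⟩)
    · obtain ⟨A, h1, h2⟩ := c.exists_arc_same hx hxy.symm
        (Or.inr ⟨hy, hx, hl.symm, by rw [hl]; exact h⟩)
      exact ⟨A, h2, h1⟩
  · exact c.exists_arc_different hx hy hl

lemma exists_connected_below (x : X) :
    ∃ T : Set X, (∀ w ∈ T, c.le w x) ∧ c.v ∈ T ∧ x ∈ T ∧ IsPreconnected T := by
  by_cases hx : x = c.v
  · exact ⟨{c.v}, fun w hw => Or.inl hw, rfl, hx, isPreconnected_singleton⟩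
  · refine ⟨_, fun w hw => c.le_of_mem_part hx (a := 0) hw, ⟨Or.inl rfl, ?_⟩,
      c.mem_part_self (c.ht_pos x hx).le, c.isPreconnected_part hx le_rfl⟩
    simp only [mem_ofPred_eq, c.ht_top]
    exact ⟨le_rfl, (c.ht_pos x hx).le⟩

lemma connectedSpace (c : FanChart X P) : ConnectedSpace X := by
  have : PreconnectedSpace X := ⟨isPreconnected_of_forall c.v fun y _ => by
    obtain ⟨T, -, h1, h2, h3⟩ := c.exists_connected_below y
    exact ⟨T, subset_univ _, h1, h2, h3⟩⟩
  exact ⟨⟨c.v⟩⟩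

lemma mem_inter_of_between {A B : Set X} (hA : IsPreconnected A) (hv : c.v ∉ A)
    (hBc : IsClosed B) (hB : IsPreconnected B) {x y : X} (hx : x ∈ A ∩ B) (hy : y ∈ A ∩ B)
    (hxy : c.ht (c.leg y) x ≤ c.ht (c.leg y) y) :
    ∃ t ⊆ A ∩ B, x ∈ t ∧ y ∈ t ∧ IsPreconnected t := by
  have hxv : x ≠ c.v := fun h => hv (h ▸ hx.1)
  have hyv : y ≠ c.v := fun h => hv (h ▸ hy.1)
  have hl := c.leg_eq_of_isPreconnected hA hv hx.1 hy.1
  have hpos : 0 < c.ht (c.leg y) x := hl ▸ c.ht_pos x hxv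
  refine ⟨c.part (c.leg y) (c.ht (c.leg y) x) (c.ht (c.leg y) y), ?_, ⟨Or.inr hl, le_rfl, hxy⟩,
    c.mem_part_self hxy, c.isPreconnected_part hyv hpos.le⟩
  rintro w ⟨hw, h1, h2⟩
  have hwv : w ≠ c.v := by
    rintro rfl
    rw [c.ht_top] at h1
    linarith
  have hwl := hw.resolve_left hwv
  refine ⟨c.mem_of_between hA hv hx.1 hy.1 hwv hwl h1 h2, ?_⟩
  by_cases hvB : c.v ∈ B
  · exact c.mem_of_below hBc hB hvB hy.2 (Or.inr ⟨hwv, hyv, hwl, h2⟩)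
  · exact c.mem_of_between hB hvB hx.2 hy.2 hwv hwl h1 h2

lemma isPreconnected_inter_of_notMem {A B : Set X} (hA : IsPreconnected A) (hv : c.v ∉ A)
    (hBc : IsClosed B) (hB : IsPreconnected B) : IsPreconnected (A ∩ B) := by
  refine isPreconnected_of_forall_pair fun x hx y hy => ?_
  rcases le_total (c.ht (c.leg y) x) (c.ht (c.leg y) y) with h | h
  · exact c.mem_inter_of_between hA hv hBc hB hx hy h
  · obtain ⟨t, h0, h1, h2, h3⟩ := c.mem_inter_of_between hA hv hBc hB hy hx
      (by rw [c.leg_eq_of_isPreconnected hA hv hx.1 hy.1]; exact h)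
    exact ⟨t, h0, h2, h1, h3⟩

lemma hereditarilyUnicoherent (c : FanChart X P) : HereditarilyUnicoherent X := by
  rintro C A B ⟨-, hC⟩ ⟨hAc, hA⟩ ⟨hBc, hB⟩ rfl
  refine ⟨?_, ?_⟩
  · have := isPreconnected_closed_iff.mp hC.isPreconnected A B hAc.isClosed hBc.isClosed
      subset_rfl (by rw [union_inter_cancel_left]; exact hA.nonempty)
      (by rw [union_inter_cancel_right]; exact hB.nonempty)
    exact this.mono inter_subset_right
  by_cases hvA : c.v ∈ A
  · by_cases hvB : c.v ∈ B
    · refine isPreconnected_of_forall c.v fun y hy => ?_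
      obtain ⟨T, h0, h1, h2, h3⟩ := c.exists_connected_below y
      exact ⟨T, fun w hw => ⟨c.mem_of_below hAc.isClosed hA.isPreconnected hvA hy.1 (h0 w hw),
        c.mem_of_below hBc.isClosed hB.isPreconnected hvB hy.2 (h0 w hw)⟩, h1, h2, h3⟩
    · rw [inter_comm]
      exact c.isPreconnected_inter_of_notMem hB.isPreconnected hvB hAc.isClosed hA.isPreconnected
  · exact c.isPreconnected_inter_of_notMem hA.isPreconnected hvA hBc.isClosed hB.isPreconnected

end FanChart

namespace FanChart

variable {X P : Type} [TopologicalSpace X] [TopologicalSpace P] [CompactSpace X] [T2Space X]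
  [CompactSpace P] [T2Space P] [TotallyDisconnectedSpace P] (c : FanChart X P)

lemma injOn_ht_of_isPreconnected {C : Set X} (hC : IsPreconnected C) (hv : c.v ∉ C) {x : X}
    (hx : x ∈ C) : InjOn (c.ht (c.leg x)) C := by
  intro y hy z hz h
  have h1 := c.leg_eq_of_isPreconnected hC hv hy hx
  have h2 := c.leg_eq_of_isPreconnected hC hv hz hx
  exact c.injOn_legSet (c.leg x) (Or.inr h1) (Or.inr h2) h

/-- A point of maximal height on its leg is an end-point of the fan. -/
lemma mem_dendroidEndpoints {x : X} (hx : x ≠ c.v)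
    (hmax : ∀ y, y ≠ c.v → c.leg y = c.leg x → c.ht (c.leg x) y ≤ c.ht (c.leg x) x) :
    x ∈ DendroidEndpoints X := by
  rintro A ⟨e⟩ hxA
  obtain ⟨⟨τ, hτ⟩, he⟩ := e.surjective ⟨x, hxA⟩
  rcases eq_or_lt_of_le hτ.1 with h0 | h0
  · subst h0
    exact ⟨e, by rw [he]⟩
  rcases eq_or_lt_of_le hτ.2 with h1 | h1
  · subst h1
    have := isArcEndpoint_reverse e
    rwa [he] at this
  exfalso
  let E : ℝ → X := fun r => e (projIcc 0 1 zero_le_one r)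
  have hE : Continuous E := continuous_subtype_val.comp (e.continuous.comp continuous_projIcc)
  have hEτ : E τ = x := by
    simp only [E]
    rw [projIcc_of_mem zero_le_one hτ, he]
  have hopen : IsOpen (E ⁻¹' {c.v}ᶜ ∩ Ioo 0 1) :=
    (isOpen_compl_singleton.preimage hE).inter isOpen_Ioo
  obtain ⟨ε, hε, hball⟩ := Metric.isOpen_iff.mp hopen τ ⟨by simp [hEτ, hx], h0, h1⟩
  have hsub : Icc (τ - ε / 2) (τ + ε / 2) ⊆ E ⁻¹' {c.v}ᶜ ∩ Ioo 0 1 := by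
    intro r hr
    apply hball
    rw [Metric.mem_ball, Real.dist_eq, abs_lt]
    constructor <;> linarith [hr.1, hr.2]
  set I := Icc (τ - ε / 2) (τ + ε / 2) with hI
  have hpre : IsPreconnected (E '' I) := isPreconnected_Icc.image _ hE.continuousOn
  have hvI : c.v ∉ E '' I := by
    rintro ⟨r, hr, h⟩
    exact (hsub hr).1 h
  have hτI : τ ∈ I := ⟨by linarith, by linarith⟩
  have hxI : x ∈ E '' I := ⟨τ, hτI, hEτ⟩
  have hinjE : InjOn E I := by
    intro r hr s hs h
    have h2 := e.injective (Subtype.ext h)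
    rw [projIcc_of_mem zero_le_one (Ioo_subset_Icc_self (hsub hr).2),
      projIcc_of_mem zero_le_one (Ioo_subset_Icc_self (hsub hs).2)] at h2
    exact congrArg Subtype.val h2
  have hinj : InjOn (c.ht (c.leg x) ∘ E) I :=
    (c.injOn_ht_of_isPreconnected hpre hvI hxI).comp hinjE (mapsTo_image E I)
  have hle : ∀ r ∈ I, (c.ht (c.leg x) ∘ E) r ≤ (c.ht (c.leg x) ∘ E) τ := by
    intro r hr
    simp only [Function.comp, hEτ]
    exact hmax _ (hsub hr).1 (c.leg_eq_of_isPreconnected hpre hvI ⟨r, hr, rfl⟩ hxI)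
  have hl : τ - ε / 2 ∈ I := ⟨le_rfl, by linarith⟩
  have hr : τ + ε / 2 ∈ I := ⟨by linarith, le_rfl⟩
  rcases ContinuousOn.strictMonoOn_of_injOn_Icc' (by linarith)
    ((c.ht_cont (c.leg x)).comp hE).continuousOn hinj with hm | hm
  · exact absurd (hm hτI hr (by linarith)) (not_lt.mpr (hle _ hr))
  · exact absurd (hm hl hτI (by linarith)) (not_lt.mpr (hle _ hl))

/-- Only the top of a fan chart can be a ramification point. -/
lemma eq_top_of_isRamificationPoint {x : X} (hx : IsRamificationPoint x) : x = c.v := by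
  obtain ⟨T, e, he⟩ := hx
  by_contra hxv
  have hV : IsOpen ((fun p : TSet => ((e p : T) : X)) ⁻¹' {c.v}ᶜ) :=
    isOpen_compl_singleton.preimage (continuous_subtype_val.comp e.continuous)
  obtain ⟨ε, hε, hball⟩ := Metric.isOpen_iff.mp hV ⟨(0, 0), zero_mem_TSet⟩ (by
    simp only [mem_preimage, he]; exact hxv)
  obtain ⟨r, hr0, hrε, hr1⟩ : ∃ r : ℝ, 0 < r ∧ r < ε ∧ r ≤ 1 :=
    ⟨min (ε / 2) 1, by positivity, (min_le_left _ _).trans_lt (by linarith), min_le_right _ _⟩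
  have hH : ∀ a ∈ Icc (-r) r, ((a, 0) : ℝ × ℝ) ∈ TSet := fun a ha =>
    Or.inl ⟨⟨by linarith [ha.1], by linarith [ha.2]⟩, rfl⟩
  have hW : ∀ a ∈ Icc 0 r, ((0, a) : ℝ × ℝ) ∈ TSet := fun a ha =>
    Or.inr ⟨rfl, ⟨ha.1, by linarith [ha.2]⟩⟩
  classical
  have hproj : Continuous (fun a : ℝ => ((projIcc (-r) r (by linarith) a : ℝ))) :=
    continuous_subtype_val.comp continuous_projIcc
  have hproj' : Continuous (fun a : ℝ => ((projIcc 0 r hr0.le a : ℝ))) :=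
    continuous_subtype_val.comp continuous_projIcc
  let E1 : ℝ → X := fun a => e ⟨(projIcc (-r) r (by linarith) a, 0), hH _ (Subtype.prop _)⟩
  let E2 : ℝ → X := fun a => e ⟨(0, projIcc 0 r hr0.le a), hW _ (Subtype.prop _)⟩
  have hE1 : Continuous E1 := continuous_subtype_val.comp (e.continuous.comp
    (Continuous.subtype_mk (hproj.prodMk continuous_const) _))
  have hE2 : Continuous E2 := continuous_subtype_val.comp (e.continuous.comp
    (Continuous.subtype_mk (continuous_const.prodMk hproj') _))
  have hE1' : ∀ a (ha : a ∈ Icc (-r) r), E1 a = e ⟨(a, 0), hH a ha⟩ := fun a ha => by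
    simp only [E1, projIcc_of_mem _ ha]
  have hE2' : ∀ a (ha : a ∈ Icc 0 r), E2 a = e ⟨(0, a), hW a ha⟩ := fun a ha => by
    simp only [E2, projIcc_of_mem _ ha]
  have h0 : (0:ℝ) ∈ Icc (-r) r := ⟨by linarith, hr0.le⟩
  have h0' : (0:ℝ) ∈ Icc 0 r := ⟨le_rfl, hr0.le⟩
  have hE10 : E1 0 = x := by rw [hE1' 0 h0, ← he]
  have hE20 : E2 0 = x := by rw [hE2' 0 h0', ← he]
  have hpre1 : IsPreconnected (E1 '' Icc (-r) r) := isPreconnected_Icc.image _ hE1.continuousOn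
  have hpre2 : IsPreconnected (E2 '' Icc 0 r) := isPreconnected_Icc.image _ hE2.continuousOn
  have hx1 : x ∈ E1 '' Icc (-r) r := ⟨0, h0, hE10⟩
  have hx2 : x ∈ E2 '' Icc 0 r := ⟨0, h0', hE20⟩
  have hpre := IsPreconnected.union x hx1 hx2 hpre1 hpre2
  have hv : c.v ∉ E1 '' Icc (-r) r ∪ E2 '' Icc 0 r := by
    rintro (⟨a, ha, h⟩ | ⟨a, ha, h⟩)
    · refine @hball ⟨(a, 0), hH a ha⟩ ?_ ((hE1' a ha).symm.trans h)
      rw [Metric.mem_ball, Subtype.dist_eq, Prod.dist_eq]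
      simp only [dist_self, Real.dist_eq, sub_zero]
      rw [max_lt_iff, abs_lt]
      exact ⟨⟨by linarith [ha.1], by linarith [ha.2]⟩, hε⟩
    · refine @hball ⟨(0, a), hW a ha⟩ ?_ ((hE2' a ha).symm.trans h)
      rw [Metric.mem_ball, Subtype.dist_eq, Prod.dist_eq]
      simp only [dist_self, Real.dist_eq, sub_zero]
      rw [max_lt_iff, abs_lt]
      exact ⟨hε, by linarith [ha.1], by linarith [ha.2]⟩
  have hinj := c.injOn_ht_of_isPreconnected hpre hv (Or.inl ⟨0, h0, hE10⟩)
  set g := c.ht (c.leg x) with hg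
  have hgc : Continuous g := c.ht_cont _
  have hinj1 : InjOn (g ∘ E1) (Icc (-r) r) := by
    refine (hinj.mono subset_union_left).comp ?_ (mapsTo_image _ _)
    intro a ha b hb h
    rw [hE1' a ha, hE1' b hb] at h
    have := congrArg Subtype.val (e.injective (Subtype.ext h))
    exact congrArg Prod.fst this
  -- a point of the vertical arm has the same height as a point of the horizontal arm
  have hclash : ∀ a ∈ Icc (-r) r, ∀ b ∈ Icc 0 r, 0 < b → g (E1 a) ≠ g (E2 b) := by
    intro a ha b hb hb0 h
    have h1 := hinj (Or.inl ⟨a, ha, rfl⟩) (Or.inr ⟨b, hb, rfl⟩) h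
    rw [hE1' a ha, hE2' b hb] at h1
    have := congrArg Prod.snd (congrArg Subtype.val (e.injective (Subtype.ext h1)))
    exact hb0.ne this
  have hnhds : g '' (E1 '' Icc (-r) r) ∈ 𝓝 (g x) := by
    have hsub : ∀ a b, a ∈ Icc (-r) r → b ∈ Icc (-r) r →
        Icc (g (E1 a)) (g (E1 b)) ⊆ g '' (E1 '' Icc (-r) r) := fun a b ha hb =>
      hpre1.intermediate_value ⟨a, ha, rfl⟩ ⟨b, hb, rfl⟩ hgc.continuousOn
    have hl : -r ∈ Icc (-r) r := ⟨le_rfl, by linarith⟩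
    have hr : r ∈ Icc (-r) r := ⟨by linarith, le_rfl⟩
    rcases ContinuousOn.strictMonoOn_of_injOn_Icc' (by linarith)
      (hgc.comp hE1).continuousOn hinj1 with hm | hm
    · have h1 := hm hl h0 (by linarith)
      have h2 := hm h0 hr (by linarith)
      simp only [Function.comp, hE10] at h1 h2
      exact mem_of_superset (Icc_mem_nhds h1 h2) (hsub _ _ hl hr)
    · have h1 := hm hl h0 (by linarith)
      have h2 := hm h0 hr (by linarith)
      simp only [Function.comp, hE10] at h1 h2
      exact mem_of_superset (Icc_mem_nhds h2 h1) (hsub _ _ hr hl)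
  have hev : ∀ᶠ b in 𝓝[>] (0:ℝ), g (E2 b) ∈ g '' (E1 '' Icc (-r) r) := by
    have ht : Tendsto (g ∘ E2) (𝓝[>] 0) (𝓝 (g x)) := by
      rw [← hE20]
      exact ((hgc.comp hE2).tendsto 0).mono_left nhdsWithin_le_nhds
    exact ht hnhds
  have hev2 : ∀ᶠ b in 𝓝[>] (0:ℝ), b ∈ Ioc 0 r := Ioc_mem_nhdsGT hr0
  obtain ⟨b, ⟨_, ⟨a, ha, rfl⟩, hab⟩, hb⟩ := (hev.and hev2).exists
  exact hclash a ha b ⟨hb.1.le, hb.2⟩ hb.1 hab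

lemma isFan [TopologicalSpace.MetrizableSpace X] (c : FanChart X P) : IsFan X :=
  ⟨⟨⟨c.v⟩, inferInstance, c.connectedSpace, inferInstance, fun _ _ h => c.exists_arc h,
    c.hereditarilyUnicoherent⟩, fun x y hx hy => by
      rw [c.eq_top_of_isRamificationPoint hx, c.eq_top_of_isRamificationPoint hy]⟩

/-- The complement of a point other than the top is the union of two preconnected sets. -/
lemma exists_cover_compl {w : X} (hw : w ≠ c.v) :
    ∃ A B : Set X, IsPreconnected A ∧ IsPreconnected B ∧ A ∪ B = {w}ᶜ := by
  refine ⟨{x | ¬ c.le w x}, {x | c.le w x ∧ x ≠ w}, ?_, ?_, ?_⟩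
  · refine isPreconnected_of_forall c.v fun y hy => ?_
    obtain ⟨T, h0, h1, h2, h3⟩ := c.exists_connected_below y
    refine ⟨T, fun z hz hwz => hy ?_, h1, h2, h3⟩
    rw [le_iff] at hwz ⊢
    intro C hC hC' hCv hyC
    exact hwz C hC hC' hCv ((c.le_iff z y).mp (h0 z hz) C hC hC' hCv hyC)
  · have key : ∀ x, c.le w x ∧ x ≠ w → x ≠ c.v ∧ c.leg w = c.leg x ∧
        c.ht (c.leg x) w < c.ht (c.leg x) x := by
      rintro x ⟨h, hxw⟩
      rcases h with h | ⟨-, hx, hl, hle⟩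
      · exact absurd h hw
      · exact ⟨hx, hl, lt_of_le_of_ne hle fun h =>
          hxw (c.ht_inj w x hw hx hl (by rw [hl]; exact h)).symm⟩
    have main : ∀ x y, (c.le w x ∧ x ≠ w) → (c.le w y ∧ y ≠ w) →
        c.ht (c.leg y) x ≤ c.ht (c.leg y) y → ∃ t ⊆ {x | c.le w x ∧ x ≠ w},
          x ∈ t ∧ y ∈ t ∧ IsPreconnected t := by
      intro x y hx hy h
      obtain ⟨hxv, hlx, h1⟩ := key x hx
      obtain ⟨hyv, hly, h2⟩ := key y hy
      have hl : c.leg x = c.leg y := hlx.symm.trans hly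
      have hpos : 0 < c.ht (c.leg y) x := hl ▸ c.ht_pos x hxv
      refine ⟨c.part (c.leg y) (c.ht (c.leg y) x) (c.ht (c.leg y) y), ?_,
        ⟨Or.inr hl, le_rfl, h⟩, c.mem_part_self h, c.isPreconnected_part hyv hpos.le⟩
      rintro z ⟨hz, h3, h4⟩
      have hzv : z ≠ c.v := by
        rintro rfl
        rw [c.ht_top] at h3
        linarith
      have hzl := hz.resolve_left hzv
      rw [hl] at h1
      have hlt := h1.trans_le h3
      refine ⟨Or.inr ⟨hw, hzv, hly.trans hzl.symm, by rw [hzl]; exact hlt.le⟩, ?_⟩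
      rintro rfl
      exact lt_irrefl _ hlt
    refine isPreconnected_of_forall_pair fun x hx y hy => ?_
    rcases le_total (c.ht (c.leg y) x) (c.ht (c.leg y) y) with h | h
    · exact main x y hx hy h
    · obtain ⟨t, h0, h1, h2, h3⟩ := main y x hy hx (by
        rw [← (key x hx).2.1, (key y hy).2.1]; exact h)
      exact ⟨t, h0, h2, h1, h3⟩
  · ext x
    simp only [mem_union, mem_ofPred_eq, mem_compl_iff, mem_singleton_iff]
    by_cases h : c.le w x
    · tauto
    · simp only [h, not_false_eq_true, false_and, or_false, true_iff]
      rintro rfl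
      exact h (Or.inr ⟨hw, hw, rfl, le_rfl⟩)

/-- If a fan has three legs then its top is preserved by every homeomorphism. -/
lemma map_top {X' P' : Type} [TopologicalSpace X'] [TopologicalSpace P'] [CompactSpace X']
    [T2Space X'] [CompactSpace P'] [T2Space P'] [TotallyDisconnectedSpace P']
    (c' : FanChart X' P') (Φ : X ≃ₜ X') {x y z : X} (hx : x ≠ c.v) (hy : y ≠ c.v) (hz : z ≠ c.v)
    (hxy : c.leg x ≠ c.leg y) (hyz : c.leg y ≠ c.leg z) (hxz : c.leg x ≠ c.leg z) :
    Φ c.v = c'.v := by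
  by_contra hv
  obtain ⟨A, B, hA, hB, hAB⟩ := c'.exists_cover_compl hv
  have hA' : IsPreconnected (Φ ⁻¹' A) := by
    rw [← Φ.image_symm]
    exact hA.image _ Φ.symm.continuous.continuousOn
  have hB' : IsPreconnected (Φ ⁻¹' B) := by
    rw [← Φ.image_symm]
    exact hB.image _ Φ.symm.continuous.continuousOn
  have hvA : c.v ∉ Φ ⁻¹' A := fun h => (hAB.le (Or.inl h)) rfl
  have hvB : c.v ∉ Φ ⁻¹' B := fun h => (hAB.le (Or.inr h)) rfl
  have hmem : ∀ u, u ≠ c.v → u ∈ Φ ⁻¹' A ∨ u ∈ Φ ⁻¹' B := fun u hu =>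
    hAB.ge (fun h => hu (Φ.injective h))
  rcases hmem x hx with h1 | h1 <;> rcases hmem y hy with h2 | h2 <;>
    rcases hmem z hz with h3 | h3
  all_goals first
    | exact hxy (c.leg_eq_of_isPreconnected hA' hvA h1 h2)
    | exact hxy (c.leg_eq_of_isPreconnected hB' hvB h1 h2)
    | exact hyz (c.leg_eq_of_isPreconnected hA' hvA h2 h3)
    | exact hyz (c.leg_eq_of_isPreconnected hB' hvB h2 h3)
    | exact hxz (c.leg_eq_of_isPreconnected hA' hvA h1 h3)
    | exact hxz (c.leg_eq_of_isPreconnected hB' hvB h1 h3)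

/-- Every homeomorphism preserving the tops preserves the orders. -/
lemma map_le {X' P' : Type} [TopologicalSpace X'] [TopologicalSpace P'] [CompactSpace X']
    [T2Space X'] [CompactSpace P'] [T2Space P'] [TotallyDisconnectedSpace P']
    (c' : FanChart X' P') (Φ : X ≃ₜ X') (hv : Φ c.v = c'.v) (x y : X) :
    c'.le (Φ x) (Φ y) ↔ c.le x y := by
  rw [le_iff, le_iff]
  constructor
  · intro h C hC hC' hCv hy
    have := h (Φ '' C) (Φ.isClosed_image.mpr hC) (hC'.image _ Φ.continuous.continuousOn)
      (hv ▸ mem_image_of_mem _ hCv) (mem_image_of_mem _ hy)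
    exact (Φ.injective.mem_set_image).mp this
  · intro h C hC hC' hCv hy
    refine h (Φ ⁻¹' C) (hC.preimage Φ.continuous) ?_ (by rw [mem_preimage, hv]; exact hCv) hy
    rw [← Φ.image_symm]
    exact hC'.image _ Φ.symm.continuous.continuousOn

/-- The points where the order of the fan fails to be closed. -/
def nonsmooth : Set X := {x | ∃ z, (z, x) ∈ closure {p : X × X | c.le p.1 p.2} ∧ ¬ c.le z x}

/-- The limits of points of non-smoothness lying on legs without such points. -/
def limitNonsmooth : Set X :=
  {x | x ≠ c.v ∧ x ∈ closure c.nonsmooth ∧ ∀ y ∈ c.nonsmooth, ¬ c.le x y ∧ ¬ c.le y x}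

lemma map_nonsmooth {X' P' : Type} [TopologicalSpace X'] [TopologicalSpace P'] [CompactSpace X']
    [T2Space X'] [CompactSpace P'] [T2Space P'] [TotallyDisconnectedSpace P']
    (c' : FanChart X' P') (Φ : X ≃ₜ X') (hv : Φ c.v = c'.v) :
    Φ ⁻¹' c'.nonsmooth = c.nonsmooth := by
  have hpre : (Φ.prodCongr Φ) ⁻¹' closure {p : X' × X' | c'.le p.1 p.2}
      = closure {p : X × X | c.le p.1 p.2} := by
    rw [Homeomorph.preimage_closure]
    congr 1
    ext p
    exact c.map_le c' Φ hv p.1 p.2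
  ext x
  constructor
  · rintro ⟨z, hz, hzx⟩
    refine ⟨Φ.symm z, ?_, ?_⟩
    · rw [← hpre]
      simpa using hz
    · rw [← c.map_le c' Φ hv]
      simpa using hzx
  · rintro ⟨z, hz, hzx⟩
    refine ⟨Φ z, ?_, ?_⟩
    · rw [← hpre] at hz
      simpa using hz
    · rwa [c.map_le c' Φ hv]

lemma map_limitNonsmooth {X' P' : Type} [TopologicalSpace X'] [TopologicalSpace P']
    [CompactSpace X'] [T2Space X'] [CompactSpace P'] [T2Space P'] [TotallyDisconnectedSpace P']
    (c' : FanChart X' P') (Φ : X ≃ₜ X') (hv : Φ c.v = c'.v) :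
    Φ ⁻¹' c'.limitNonsmooth = c.limitNonsmooth := by
  have hN := c.map_nonsmooth c' Φ hv
  ext x
  simp only [limitNonsmooth, mem_preimage, mem_ofPred_eq]
  refine and_congr ?_ (and_congr ?_ ?_)
  · rw [← hv, Φ.injective.ne_iff]
  · rw [← hN, ← Homeomorph.preimage_closure]
    rfl
  · rw [← hN]
    constructor
    · intro h y hy
      have := h (Φ y) hy
      rwa [c.map_le c' Φ hv, c.map_le c' Φ hv] at this
    · intro h y hy
      have := h (Φ.symm y) (by simpa using hy)
      rw [← c.map_le c' Φ hv, ← c.map_le c' Φ hv] at this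
      simpa using this

end FanChart

/-- The signed partial sums of a bi-infinite sequence, vanishing at `0`. -/
noncomputable def signedSum (w : ℤ → ℝ) (k : ℤ) : ℝ :=
  ∑ i ∈ Finset.Ico 0 k, w i - ∑ i ∈ Finset.Ico k 0, w i

@[simp] lemma signedSum_zero (w : ℤ → ℝ) : signedSum w 0 = 0 := by simp [signedSum]

lemma signedSum_succ (w : ℤ → ℝ) (k : ℤ) : signedSum w (k + 1) = signedSum w k + w k := by
  unfold signedSum
  rcases le_or_gt 0 k with hk | hk
  · have h1 : Finset.Ico 0 (k + 1) = insert k (Finset.Ico 0 k) := by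
      ext i; simp only [Finset.mem_Ico, Finset.mem_insert]; omega
    have h2 : Finset.Ico (k + 1) 0 = ∅ := by ext i; simp; omega
    have h3 : Finset.Ico k 0 = ∅ := by ext i; simp; omega
    rw [h1, h2, h3, Finset.sum_insert (by simp)]
    simp [add_comm]
  · have h1 : Finset.Ico k 0 = insert k (Finset.Ico (k + 1) 0) := by
      ext i; simp only [Finset.mem_Ico, Finset.mem_insert]; omega
    have h2 : Finset.Ico 0 (k + 1) = ∅ := by ext i; simp; omega
    have h3 : Finset.Ico 0 k = ∅ := by ext i; simp; omega
    rw [h1, h2, h3, Finset.sum_insert (by simp)]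
    simp

lemma signedSum_sub_of_eqOn {w₁ w₂ : ℤ → ℝ} {n a b : ℤ}
    (h : ∀ i, a ≤ i → i < b → w₁ i = w₂ (i - n)) (k : ℤ) (hak : a ≤ k) (hkb : k ≤ b) :
    signedSum w₁ k - signedSum w₁ a = signedSum w₂ (k - n) - signedSum w₂ (a - n) := by
  induction k, hak using Int.leInduction with
  | base => ring
  | succ k hak ih =>
    have := ih (by omega)
    rw [show k + 1 - n = (k - n) + 1 by ring, signedSum_succ, signedSum_succ,
      h k hak (by omega)]
    linarith

lemma signedSum_shift (w : ℤ → ℝ) (n k : ℤ) :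
    signedSum (fun i => w (i + n)) k = signedSum w (k + n) - signedSum w n := by
  have key : ∀ a b : ℤ, a ≤ b → signedSum (fun i => w (i + n)) b - signedSum (fun i => w (i + n)) a
      = signedSum w (b + n) - signedSum w (a + n) := fun a b hab => by
    have := signedSum_sub_of_eqOn (w₁ := fun i => w (i + n)) (w₂ := w) (n := -n) (a := a) (b := b)
      (fun i _ _ => by simp) b hab le_rfl
    simpa using this
  rcases le_total 0 k with hk | hk
  · simpa using key 0 k hk
  · have := key k 0 hk
    simp only [signedSum_zero, zero_add] at this
    linarith

lemma signedSum_eq_zero {w : ℤ → ℝ} (h : ∀ k, w k = 0) (k : ℤ) : signedSum w k = 0 := by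
  simp [signedSum, h]

/-- The convergent sequence of the numbers `1 / (n + 1)` together with its limit. -/
def seqSet : Set ℝ := insert 0 (range fun n : ℕ => 1 / ((n : ℝ) + 1))

/-- The two-sided version of `seqSet`. -/
def symmSeqSet : Set ℝ := seqSet ∪ Neg.neg '' seqSet

lemma isCompact_seqSet : IsCompact seqSet :=
  tendsto_one_div_add_atTop_nhds_zero_nat.isCompact_insert_range

lemma countable_seqSet : seqSet.Countable := (countable_range _).insert _

instance : CompactSpace seqSet := isCompact_iff_compactSpace.mp isCompact_seqSet

instance : CompactSpace symmSeqSet :=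
  isCompact_iff_compactSpace.mp (isCompact_seqSet.union (isCompact_seqSet.image continuous_neg))

instance : Countable seqSet := countable_seqSet

instance : Countable symmSeqSet := (countable_seqSet.union (countable_seqSet.image _)).to_subtype

lemma zero_mem_seqSet : (0 : ℝ) ∈ seqSet := mem_insert _ _

lemma mem_seqSet (n : ℕ) : 1 / ((n : ℝ) + 1) ∈ seqSet := mem_insert_of_mem _ ⟨n, rfl⟩

lemma zero_mem_symmSeqSet : (0 : ℝ) ∈ symmSeqSet := Or.inl zero_mem_seqSet

lemma seqSet_bounds {z : ℝ} (hz : z ∈ seqSet) : 0 ≤ z ∧ z ≤ 1 := by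
  rcases hz with rfl | ⟨n, rfl⟩
  · simp
  · exact ⟨by positivity, (div_le_one (by positivity)).mpr
      (by linarith [Nat.cast_nonneg (α := ℝ) n])⟩

lemma eventually_eq_of_pos (z : seqSet) (hz : (z : ℝ) ≠ 0) : ∀ᶠ y in 𝓝 z, y = z := by
  obtain ⟨n, hn⟩ : ∃ n : ℕ, 1 / ((n : ℝ) + 1) = z := by
    rcases z.2 with h | h
    · exact absurd h hz
    · exact h
  have hc : Tendsto (fun y : seqSet => (y : ℝ)⁻¹) (𝓝 z) (𝓝 (z : ℝ)⁻¹) :=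
    (continuous_subtype_val.continuousAt).inv₀ hz
  have := hc.eventually (Metric.ball_mem_nhds _ one_pos)
  filter_upwards [this] with y hy
  rw [Real.dist_eq, abs_lt, ← hn] at hy
  apply Subtype.ext
  rcases y.2 with h | ⟨m, hm⟩
  · rw [h] at hy
    simp at hy
    linarith [Nat.cast_nonneg (α := ℝ) n]
  · simp only at hm
    rw [← hm] at hy
    simp only [one_div, inv_inv] at hy
    have h1 : (m : ℝ) < n + 1 := by linarith
    have h2 : (n : ℝ) < m + 1 := by linarith
    have h3 : m = n := by
      have : m < n + 1 := by exact_mod_cast h1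
      have : n < m + 1 := by exact_mod_cast h2
      omega
    rw [← hm, ← hn, h3]

/-- The positions of the folds: for each `z`, a number in `(0, 1/2]`. -/
structure FoldData where
  pos : ℝ → ℝ
  pos_pos : ∀ z, 0 < pos z
  pos_le : ∀ z, pos z ≤ 1 / 2

namespace FoldData

variable (d : FoldData)

/-- The size of the fold at parameter `z`. -/
noncomputable def size (z : ℝ) : ℝ := z * d.pos z / 8

/-- A piecewise linear map folding `[0,1]` near the point `d.pos z`. -/
noncomputable def fold (z t : ℝ) : ℝ := t + 2 * max 0 (d.size z - |t - d.pos z|)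

lemma size_nonneg {z : ℝ} (hz : 0 ≤ z) : 0 ≤ d.size z := by
  have := (d.pos_pos z).le
  unfold size; positivity

lemma size_pos {z : ℝ} (hz : 0 < z) : 0 < d.size z := by
  have := (d.pos_pos z)
  unfold size; positivity

lemma size_le {z : ℝ} (hz : 0 ≤ z) : 16 * d.size z ≤ z := by
  have := d.pos_le z
  unfold size
  nlinarith

lemma size_le_pos {z : ℝ} (hz : z ≤ 1) : 8 * d.size z ≤ d.pos z := by
  have := d.pos_pos z
  unfold size
  nlinarith

lemma le_fold (z t : ℝ) : t ≤ d.fold z t := by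
  have := le_max_left 0 (d.size z - |t - d.pos z|)
  unfold fold
  linarith

lemma fold_le_add {z : ℝ} (hz : 0 ≤ z) (t : ℝ) : d.fold z t ≤ t + z := by
  have : max 0 (d.size z - |t - d.pos z|) ≤ d.size z :=
    max_le (d.size_nonneg hz) (by linarith [abs_nonneg (t - d.pos z)])
  have := d.size_le hz
  have := d.size_nonneg hz
  unfold fold
  linarith

lemma fold_of_far {z t : ℝ} (h : d.size z ≤ |t - d.pos z|) : d.fold z t = t := by
  rw [fold, max_eq_left (by linarith)]; ring

lemma fold_of_near {z t : ℝ} (h : |t - d.pos z| ≤ d.size z) :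
    d.fold z t = t + 2 * (d.size z - |t - d.pos z|) := by
  rw [fold, max_eq_right (by linarith)]

lemma fold_zero {z : ℝ} (hz : z ∈ seqSet) : d.fold z 0 = 0 := by
  obtain ⟨h0, h1⟩ := seqSet_bounds hz
  refine d.fold_of_far ?_
  have := d.size_le_pos h1
  have := d.pos_pos z
  have := d.size_nonneg h0
  rw [zero_sub, abs_neg, abs_of_pos (d.pos_pos z)]
  linarith

lemma fold_one {z : ℝ} (hz : z ∈ seqSet) : d.fold z 1 = 1 := by
  obtain ⟨h0, h1⟩ := seqSet_bounds hz
  refine d.fold_of_far ?_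
  have := d.size_le_pos h1
  have := d.pos_le z
  have := d.size_nonneg h0
  rw [abs_of_pos (by linarith)]
  linarith

lemma fold_le_one {z t : ℝ} (hz : z ∈ seqSet) (ht : t ≤ 1) : d.fold z t ≤ 1 := by
  obtain ⟨h0, h1⟩ := seqSet_bounds hz
  rcases le_total (d.size z) |t - d.pos z| with h | h
  · rwa [d.fold_of_far h]
  · rw [d.fold_of_near h]
    have := d.size_le_pos h1
    have := d.pos_le z
    have := le_abs_self (t - d.pos z)
    have := abs_nonneg (t - d.pos z)
    linarith

lemma fold_pos_iff {z t : ℝ} (hz : z ∈ seqSet) (ht : 0 ≤ t) : 0 < d.fold z t ↔ 0 < t := by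
  refine ⟨fun h => ht.lt_of_ne ?_, fun h => h.trans_le (d.le_fold z t)⟩
  rintro rfl
  exact h.ne' (d.fold_zero hz)

/-- Where the fold reverses the order, the values are close to `d.pos z`. -/
lemma of_fold_lt {z t t' : ℝ} (hz : z ∈ seqSet) (h : t' ≤ t) (hlt : d.fold z t < d.fold z t') :
    0 < z ∧ |d.fold z t - d.pos z| ≤ z := by
  obtain ⟨h0, h1⟩ := seqSet_bounds hz
  have hnear : |t' - d.pos z| < d.size z := by
    by_contra hfar
    rw [d.fold_of_far (not_lt.mp hfar)] at hlt
    linarith [d.le_fold z t]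
  have hpos : 0 < d.size z := (abs_nonneg _).trans_lt hnear
  have h2 := d.fold_of_near hnear.le
  have h3 := d.le_fold z t
  have h4 := d.size_le h0
  have h5 := neg_abs_le (t' - d.pos z)
  have h6 := le_abs_self (t' - d.pos z)
  have h7 := abs_nonneg (t' - d.pos z)
  refine ⟨h0.lt_of_ne ?_, ?_⟩
  · rintro rfl
    simp [size] at hpos
  · rw [abs_le]
    constructor <;> linarith

lemma continuous_fold : Continuous fun p : seqSet × ℝ => d.fold p.1 p.2 := by
  rw [continuous_iff_continuousAt]
  rintro ⟨z, t⟩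
  by_cases hz : (z : ℝ) = 0
  · have hval : d.fold z t = t := d.fold_of_far (by simp [hz, size])
    rw [ContinuousAt, hval]
    have h1 : Tendsto (fun p : seqSet × ℝ => p.2) (𝓝 (z, t)) (𝓝 t) :=
      continuous_snd.tendsto (z, t)
    have h2 : Tendsto (fun p : seqSet × ℝ => p.2 + p.1) (𝓝 (z, t)) (𝓝 t) := by
      have : Continuous fun p : seqSet × ℝ => p.2 + p.1 := by fun_prop
      have := this.tendsto (z, t)
      simpa [hz] using this
    exact tendsto_of_tendsto_of_tendsto_of_le_of_le h1 h2 (fun p => d.le_fold _ _)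
      (fun p => d.fold_le_add (seqSet_bounds p.1.2).1 _)
  · have hc : Continuous fun p : seqSet × ℝ => d.fold z p.2 := by
      unfold fold; fun_prop
    refine hc.continuousAt.congr ?_
    have : ∀ᶠ p : seqSet × ℝ in 𝓝 (z, t), p.1 = z :=
      (continuous_fst.tendsto (z, t)).eventually (eventually_eq_of_pos z hz)
    filter_upwards [this] with p hp
    rw [hp]

end FoldData

/-- The labels of the legs: pairs of bi-infinite sequences. -/
abbrev Label : Type := (ℤ → seqSet) × (ℤ → symmSeqSet)

namespace Label

/-- The growth of heights along the orbit of a label. -/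
noncomputable def growth (s : Label) (k : ℤ) : ℝ := signedSum (fun i => (s.2 i : ℝ)) k

/-- The distance of a label from the fixed labels, measured at one coordinate. -/
noncomputable def defect (s : Label) (k : ℤ) : ℝ := |(s.1 k : ℝ) - s.1 0| + |(s.2 k : ℝ)|

/-- The labels fixed by the shift whose height does not change. -/
def IsFixed (s : Label) : Prop := ∀ k, s.defect k = 0

/-- The shift by `n`. -/
def shift (s : Label) (n : ℤ) : Label := (fun k => s.1 (k + n), fun k => s.2 (k + n))

lemma isFixed_iff {s : Label} : s.IsFixed ↔ ∀ k, s.1 k = s.1 0 ∧ (s.2 k : ℝ) = 0 := by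
  refine forall_congr' fun k => ?_
  rw [defect, add_eq_zero_iff_of_nonneg (abs_nonneg _) (abs_nonneg _), abs_eq_zero, abs_eq_zero,
    sub_eq_zero, Subtype.coe_inj]

lemma defect_nonneg (s : Label) (k : ℤ) : 0 ≤ s.defect k := by unfold defect; positivity

lemma growth_zero (s : Label) : s.growth 0 = 0 := signedSum_zero _

lemma growth_shift (s : Label) (n k : ℤ) : (s.shift n).growth k = s.growth (k + n) - s.growth n :=
  signedSum_shift (fun i => (s.2 i : ℝ)) n k

lemma IsFixed.growth {s : Label} (h : s.IsFixed) (k : ℤ) : s.growth k = 0 :=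
  signedSum_eq_zero (fun i => (isFixed_iff.mp h i).2) k

lemma shift_shift (s : Label) (m n : ℤ) : (s.shift m).shift n = s.shift (n + m) := by
  simp only [shift, add_assoc]

@[simp] lemma shift_zero (s : Label) : s.shift 0 = s := by simp [shift]

lemma IsFixed.shift_eq {s : Label} (h : s.IsFixed) (n : ℤ) : s.shift n = s := by
  rw [isFixed_iff] at h
  refine Prod.ext (funext fun k => ?_) (funext fun k => Subtype.ext ?_)
  · exact (h (k + n)).1.trans (h k).1.symm
  · exact (h (k + n)).2.trans (h k).2.symm

@[fun_prop] lemma continuous_growth (k : ℤ) : Continuous fun s : Label => s.growth k := by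
  unfold growth signedSum; fun_prop

@[fun_prop] lemma continuous_defect (k : ℤ) : Continuous fun s : Label => s.defect k := by
  unfold defect; fun_prop

@[fun_prop] lemma continuous_shift (n : ℤ) : Continuous fun s : Label => s.shift n := by
  unfold shift; fun_prop

end Label

/-- The points of the Cantor fan all of whose images under the skew shift have height at most
`1`. -/
def Base : Set (ℝ × Label) := {p | 0 ≤ p.1 ∧ ∀ k, p.1 * Real.exp (p.2.growth k) ≤ 1}

namespace Base

lemma le_one {p : ℝ × Label} (hp : p ∈ Base) : p.1 ≤ 1 := by
  simpa [Label.growth_zero] using hp.2 0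

lemma isClosed : IsClosed Base := by
  have : Base = {p : ℝ × Label | 0 ≤ p.1} ∩
      ⋂ k, {p : ℝ × Label | p.1 * Real.exp (p.2.growth k) ≤ 1} := by
    ext p; simp [Base]
  rw [this]
  refine (isClosed_le continuous_const continuous_fst).inter (isClosed_iInter fun k => ?_)
  exact isClosed_le (by fun_prop) continuous_const

lemma isCompact : IsCompact Base :=
  (isCompact_Icc (a := (0 : ℝ)) (b := 1) |>.prod (isCompact_univ (X := Label))).of_isClosed_subset
    isClosed fun _ hp => ⟨⟨hp.1, le_one hp⟩, mem_univ _⟩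

instance : CompactSpace Base := isCompact_iff_compactSpace.mp isCompact

lemma mem_of_le {t t' : ℝ} {s : Label} (h : (t, s) ∈ Base) (h0 : 0 ≤ t') (h1 : t' ≤ t) :
    (t', s) ∈ Base :=
  ⟨h0, fun k => (mul_le_mul_of_nonneg_right h1 (Real.exp_nonneg _)).trans (h.2 k)⟩

lemma zero_mem (s : Label) : ((0 : ℝ), s) ∈ Base := ⟨le_rfl, fun k => by simp⟩

lemma mem_of_isFixed {t : ℝ} {s : Label} (hs : s.IsFixed) (h0 : 0 ≤ t) (h1 : t ≤ 1) :
    (t, s) ∈ Base := ⟨h0, fun k => by simpa [hs.growth k] using h1⟩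

/-- The skew shift. -/
noncomputable def step (n : ℤ) (p : ℝ × Label) : ℝ × Label :=
  (p.1 * Real.exp (p.2.growth n), p.2.shift n)

lemma step_mem (n : ℤ) {p : ℝ × Label} (hp : p ∈ Base) : step n p ∈ Base := by
  refine ⟨mul_nonneg hp.1 (Real.exp_nonneg _), fun k => ?_⟩
  simp only [step, Label.growth_shift]
  rw [mul_assoc, ← Real.exp_add, add_sub_cancel]
  exact hp.2 _

lemma step_step (m n : ℤ) (p : ℝ × Label) : step n (step m p) = step (n + m) p := by
  simp only [step, Label.growth_shift, Label.shift_shift]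
  rw [mul_assoc, ← Real.exp_add, add_sub_cancel]

lemma step_zero (p : ℝ × Label) : step 0 p = p := by simp [step, Label.growth_zero]

lemma continuous_step (n : ℤ) : Continuous (step n) := by
  unfold step; fun_prop

/-- The skew shift as a map of the base space. -/
noncomputable def next (n : ℤ) (p : Base) : Base := ⟨step n p, step_mem n p.2⟩

lemma continuous_next (n : ℤ) : Continuous (next n) :=
  ((continuous_step n).comp continuous_subtype_val).subtype_mk _

lemma next_next (m n : ℤ) (p : Base) : next n (next m p) = next (n + m) p :=
  Subtype.ext (step_step m n p)

lemma next_zero (p : Base) : next 0 p = p := Subtype.ext (step_zero _)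

lemma next_iterate (n : ℕ) (p : Base) : (next 1)^[n] p = next n p := by
  induction n with
  | zero => simp [next_zero]
  | succ n ih => rw [Function.iterate_succ_apply', ih, next_next]; push_cast; rw [add_comm]

end Base

namespace FoldData

variable (d : FoldData)

/-- The height of a point after folding. -/
noncomputable def foldHeight (p : ℝ × Label) : ℝ := d.fold (p.2.1 0) p.1

/-- The map collapsing the top of the Cantor fan and folding the legs with fixed labels. -/
noncomputable def code (p : ℝ × Label) (k : ℤ) : ℝ × ℝ × ℝ × ℝ :=
  (d.foldHeight p, d.foldHeight p * p.2.1 k, d.foldHeight p * p.2.2 k, p.1 * p.2.defect k)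

@[fun_prop] lemma continuous_foldHeight : Continuous d.foldHeight :=
  d.continuous_fold.comp (f := fun p : ℝ × Label => (p.2.1 0, p.1)) (by fun_prop)

lemma continuous_code : Continuous d.code := by
  unfold code; fun_prop

/-- The fan attached to the fold data. -/
def Space : Type := range fun p : Base => d.code p

noncomputable instance : TopologicalSpace d.Space :=
  inferInstanceAs (TopologicalSpace (range fun p : Base => d.code p))

instance : TopologicalSpace.MetrizableSpace d.Space :=
  inferInstanceAs (TopologicalSpace.MetrizableSpace (range fun p : Base => d.code p))

/-- The quotient map onto the fan. -/
noncomputable def proj (p : Base) : d.Space := ⟨d.code p, mem_range_self p⟩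

lemma continuous_proj : Continuous d.proj :=
  (d.continuous_code.comp continuous_subtype_val).subtype_mk _

lemma surjective_proj : Function.Surjective d.proj := by
  rintro ⟨_, p, rfl⟩; exact ⟨p, rfl⟩

instance : CompactSpace d.Space := d.surjective_proj.compactSpace d.continuous_proj

lemma isQuotientMap_proj : IsQuotientMap d.proj :=
  d.continuous_proj.isClosedMap.isQuotientMap d.continuous_proj d.surjective_proj

lemma fold_pos {p : ℝ × Label} (hp : p ∈ Base) : 0 < d.foldHeight p ↔ 0 < p.1 :=
  d.fold_pos_iff (p.2.1 0).2 hp.1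

lemma foldHeight_eq_zero {p : ℝ × Label} (hp : p.1 = 0) : d.foldHeight p = 0 := by
  rw [foldHeight, hp, d.fold_zero (p.2.1 0).2]

lemma proj_eq_iff {p q : Base} : d.proj p = d.proj q ↔
    (p.1.1 = 0 ∧ q.1.1 = 0) ∨ (p.1.2 = q.1.2 ∧ (p.1.1 = q.1.1 ∨
      (p.1.2.IsFixed ∧ d.foldHeight p = d.foldHeight q))) := by
  constructor
  · intro h
    have h1 : ∀ k, d.code p k = d.code q k := fun k => congrFun (Subtype.ext_iff.mp h) k
    simp only [code, Prod.mk.injEq] at h1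
    have hu := (h1 0).1
    rcases p.2.1.eq_or_lt with h0 | h0
    · left
      refine ⟨h0.symm, ?_⟩
      rw [d.foldHeight_eq_zero h0.symm] at hu
      by_contra h2
      exact ((d.fold_pos q.2).mpr (q.2.1.lt_of_ne (Ne.symm h2))).ne hu
    · right
      have hp := (d.fold_pos p.2).mpr h0
      have hs : p.1.2 = q.1.2 := by
        refine Prod.ext (funext fun k => Subtype.ext ?_) (funext fun k => Subtype.ext ?_)
        · have := (h1 k).2.1
          rw [← hu] at this
          exact mul_left_cancel₀ hp.ne' this
        · have := (h1 k).2.2.1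
          rw [← hu] at this
          exact mul_left_cancel₀ hp.ne' this
      refine ⟨hs, ?_⟩
      by_cases hf : p.1.2.IsFixed
      · exact Or.inr ⟨hf, hu⟩
      · left
        obtain ⟨k, hk⟩ := not_forall.mp hf
        have := (h1 k).2.2.2
        rw [← hs] at this
        exact mul_right_cancel₀ hk this
  · rintro (⟨h1, h2⟩ | ⟨hs, h | ⟨hf, h⟩⟩)
    · refine Subtype.ext (funext fun k => ?_)
      change d.code p k = d.code q k
      simp [code, d.foldHeight_eq_zero h1, d.foldHeight_eq_zero h2, h1, h2]
    · exact congrArg _ (Subtype.ext (Prod.ext h hs))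
    · refine Subtype.ext (funext fun k => ?_)
      change d.code p k = d.code q k
      simp only [code, ← hs, h, hf k, mul_zero]

/-- The top of the fan. -/
noncomputable def top : d.Space := d.proj ⟨(0, (fun _ => ⟨0, zero_mem_seqSet⟩,
  fun _ => ⟨0, zero_mem_symmSeqSet⟩)), Base.zero_mem _⟩

lemma proj_eq_top {p : Base} : d.proj p = d.top ↔ p.1.1 = 0 := by
  rw [top, proj_eq_iff]
  constructor
  · rintro (h | ⟨h, h1 | ⟨h1, h2⟩⟩)
    · exact h.1
    · exact h1
    · by_contra h0
      rw [d.foldHeight_eq_zero (p := ((0 : ℝ), _)) rfl] at h2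
      exact ((d.fold_pos p.2).mpr (p.2.1.lt_of_ne (Ne.symm h0))).ne' h2
  · exact fun h => Or.inl ⟨h, rfl⟩

lemma proj_ne_top {p : Base} : d.proj p ≠ d.top ↔ 0 < p.1.1 := by
  rw [Ne, proj_eq_top]
  exact ⟨fun h => p.2.1.lt_of_ne (Ne.symm h), fun h => ne_of_gt h⟩

/-- A preimage in the base space. -/
noncomputable def lift (x : d.Space) : Base := (d.surjective_proj x).choose

lemma proj_lift (x : d.Space) : d.proj (d.lift x) = x := (d.surjective_proj x).choose_spec

/-- The label of the leg through a point. -/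
noncomputable def label (x : d.Space) : Label := (d.lift x).1.2

lemma label_proj {p : Base} (hp : 0 < p.1.1) : d.label (d.proj p) = p.1.2 := by
  have := d.proj_lift (d.proj p)
  rw [proj_eq_iff] at this
  rcases this with h | h
  · exact absurd h.2 hp.ne'
  · exact h.1

open Classical in
/-- The coordinate along the leg with label `s`. -/
noncomputable def height (s : Label) (x : d.Space) : ℝ :=
  if h : ∃ k, s.defect k ≠ 0 then (x.1 h.choose).2.2.2 else (x.1 0).1

lemma continuous_height (s : Label) : Continuous (d.height s) := by
  have : ∀ k : ℤ, Continuous fun x : d.Space => (x.1 k) := fun k =>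
    (continuous_apply k).comp continuous_subtype_val
  unfold height
  split_ifs with h
  · exact (this _).snd.snd.snd
  · exact (this _).fst

lemma height_of_isFixed {s : Label} (h : s.IsFixed) (p : Base) :
    d.height s (d.proj p) = d.foldHeight p := by
  rw [height, dif_neg (by push Not; exact h)]
  rfl

lemma height_of_not_isFixed {s : Label} (h : ¬ s.IsFixed) :
    ∃ k, 0 < s.defect k ∧ ∀ p : Base, d.height s (d.proj p) = p.1.1 * p.1.2.defect k := by
  have h' : ∃ k, s.defect k ≠ 0 := not_forall.mp h
  refine ⟨h'.choose, (s.defect_nonneg _).lt_of_ne' h'.choose_spec, fun p => ?_⟩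
  rw [height, dif_pos h']
  rfl

/-- The fan structure of the space. -/
noncomputable def chart : FanChart d.Space Label where
  v := d.top
  leg := d.label
  ht := d.height
  leg_cont := by
    rw [continuousOn_iff_isClosed]
    intro C hC
    refine ⟨d.proj '' {p : Base | p.1.2 ∈ C}, ?_, ?_⟩
    · exact d.continuous_proj.isClosedMap _
        (hC.preimage (continuous_snd.comp continuous_subtype_val))
    · ext x
      obtain ⟨p, rfl⟩ := d.surjective_proj x
      refine and_congr_left fun hx => ?_
      have hp := d.proj_ne_top.mp hx
      rw [mem_preimage, d.label_proj hp]
      refine ⟨fun h => mem_image_of_mem _ h, ?_⟩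
      rintro ⟨q, hq, hqp⟩
      have hq0 : 0 < q.1.1 := by
        rw [← hqp] at hx
        exact d.proj_ne_top.mp hx
      rw [← d.label_proj hp, ← hqp, d.label_proj hq0]
      exact hq
  ht_cont := d.continuous_height
  ht_top s := by
    by_cases hs : s.IsFixed
    · rw [top, d.height_of_isFixed hs]
      exact d.foldHeight_eq_zero rfl
    · obtain ⟨k, hk, h⟩ := d.height_of_not_isFixed hs
      rw [top, h]
      exact zero_mul _
  ht_pos x hx := by
    obtain ⟨p, rfl⟩ := d.surjective_proj x
    have hp := d.proj_ne_top.mp hx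
    rw [d.label_proj hp]
    by_cases hs : p.1.2.IsFixed
    · rw [d.height_of_isFixed hs]
      exact (d.fold_pos p.2).mpr hp
    · obtain ⟨k, hk, h⟩ := d.height_of_not_isFixed hs
      rw [h]
      positivity
  ht_inj x y hx hy hl hxy := by
    obtain ⟨p, rfl⟩ := d.surjective_proj x
    obtain ⟨q, rfl⟩ := d.surjective_proj y
    have hp := d.proj_ne_top.mp hx
    have hq := d.proj_ne_top.mp hy
    rw [d.label_proj hp, d.label_proj hq] at hl
    rw [d.label_proj hp] at hxy
    rw [proj_eq_iff]
    refine Or.inr ⟨hl, ?_⟩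
    by_cases hs : p.1.2.IsFixed
    · rw [d.height_of_isFixed hs, d.height_of_isFixed hs] at hxy
      exact Or.inr ⟨hs, hxy⟩
    · obtain ⟨k, hk, h⟩ := d.height_of_not_isFixed hs
      rw [h, h, ← hl] at hxy
      exact Or.inl (mul_right_cancel₀ hk.ne' hxy)
  ht_surj x hx r hr hrx := by
    obtain ⟨p, rfl⟩ := d.surjective_proj x
    have hp := d.proj_ne_top.mp hx
    rw [d.label_proj hp] at hrx ⊢
    suffices ∃ t, ∃ h0 : 0 < t, ∃ ht : t ≤ p.1.1,
        d.height p.1.2 (d.proj ⟨(t, p.1.2), Base.mem_of_le p.2 h0.le ht⟩) = r by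
      obtain ⟨t, h0, ht, htr⟩ := this
      exact ⟨d.proj ⟨(t, p.1.2), Base.mem_of_le p.2 h0.le ht⟩, d.proj_ne_top.mpr h0,
        d.label_proj h0, htr⟩
    by_cases hs : p.1.2.IsFixed
    · rw [d.height_of_isFixed hs] at hrx
      simp only [d.height_of_isFixed hs]
      have hc : ContinuousOn (fun t => d.foldHeight (t, p.1.2)) (Icc 0 p.1.1) := by fun_prop
      have := intermediate_value_Icc hp.le hc
      obtain ⟨t, ht, htr⟩ := this
        ⟨by rw [d.foldHeight_eq_zero (p := (0, p.1.2)) rfl]; exact hr.le, hrx⟩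
      refine ⟨t, ht.1.lt_of_ne ?_, ht.2, htr⟩
      rintro rfl
      exact hr.ne' (htr.symm.trans (d.foldHeight_eq_zero (p := (0, p.1.2)) rfl))
    · obtain ⟨k, hk, h⟩ := d.height_of_not_isFixed hs
      rw [h] at hrx
      simp only [h]
      exact ⟨r / p.1.2.defect k, by positivity, (div_le_iff₀ hk).mpr hrx, div_mul_cancel₀ _ hk.ne'⟩

lemma proj_next_eq {p q : Base} (n : ℤ) (h : d.proj p = d.proj q) :
    d.proj (Base.next n p) = d.proj (Base.next n q) := by
  rw [proj_eq_iff] at h ⊢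
  rcases h with ⟨h1, h2⟩ | ⟨hs, h | ⟨hf, h⟩⟩
  · left
    simp [Base.next, Base.step, h1, h2]
  · right
    have : p = q := Subtype.ext (Prod.ext h hs)
    subst this
    exact ⟨rfl, Or.inl rfl⟩
  · right
    have hf' := hs ▸ hf
    have hp : Base.step n p.1 = p.1 := by
      refine Prod.ext ?_ (hf.shift_eq n)
      simp [Base.step, hf.growth n]
    have hq : Base.step n q.1 = q.1 := by
      refine Prod.ext ?_ (hf'.shift_eq n)
      simp [Base.step, hf'.growth n]
    simp only [Base.next, hp, hq]
    exact ⟨hs, Or.inr ⟨hf, h⟩⟩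

/-- The homeomorphism of the fan induced by the skew shift. -/
noncomputable def map (n : ℤ) (x : d.Space) : d.Space := d.proj (Base.next n (d.lift x))

lemma map_proj (n : ℤ) (p : Base) : d.map n (d.proj p) = d.proj (Base.next n p) :=
  d.proj_next_eq n (d.proj_lift _)

lemma continuous_map (n : ℤ) : Continuous (d.map n) := by
  rw [d.isQuotientMap_proj.continuous_iff]
  have : d.map n ∘ d.proj = d.proj ∘ Base.next n := funext (d.map_proj n)
  rw [this]
  exact d.continuous_proj.comp (Base.continuous_next n)

lemma map_map_neg (n : ℤ) (x : d.Space) : d.map n (d.map (-n) x) = x := by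
  obtain ⟨p, rfl⟩ := d.surjective_proj x
  rw [map_proj, map_proj, Base.next_next]
  simp [Base.next_zero]

lemma isHomeomorph_map (n : ℤ) : IsHomeomorph (d.map n) := by
  refine (Homeomorph.mk ⟨d.map n, d.map (-n), fun x => ?_, d.map_map_neg n⟩ (d.continuous_map n)
    (d.continuous_map (-n))).isHomeomorph
  simpa using d.map_map_neg (-n) x

lemma map_iterate (n : ℕ) (p : Base) : (d.map 1)^[n] (d.proj p) = d.proj (Base.next n p) := by
  induction n with
  | zero => simp [Base.next_zero]
  | succ n ih =>
    rw [Function.iterate_succ_apply', ih, map_proj, Base.next_next]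
    push_cast
    rw [add_comm]

end FoldData

lemma signedSum_sub_of_const {w : ℤ → ℝ} {e : ℝ} {a b : ℤ} (h : ∀ i, a ≤ i → i < b → w i = e)
    (k : ℤ) (hak : a ≤ k) (hkb : k ≤ b) : signedSum w k - signedSum w a = (k - a) * e := by
  induction k, hak using Int.leInduction with
  | base => ring
  | succ k hak ih =>
    have := ih (by omega)
    rw [signedSum_succ, h k hak (by omega)]
    push_cast
    linarith

/-- The multiples of the numbers in `symmSeqSet` are dense in the real line. -/
lemma exists_mul_mem_Ioo {a b : ℝ} (h : a < b) :
    ∃ (L : ℕ) (e : symmSeqSet), a < L * (e : ℝ) ∧ L * (e : ℝ) < b := by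
  obtain ⟨q, hq1, hq2⟩ := exists_rat_btwn h
  have hden : (q.den : ℝ) = ((q.den - 1 : ℕ) : ℝ) + 1 := by
    have := q.den_pos
    rw [← Nat.cast_add_one]
    congr 1
    omega
  have hmem : 1 / (q.den : ℝ) ∈ seqSet := by rw [hden]; exact mem_seqSet _
  have hqv : (q : ℝ) = q.num / q.den := Rat.cast_def q
  rcases le_total 0 q.num with h0 | h0
  · refine ⟨q.num.natAbs, ⟨_, Or.inl hmem⟩, ?_⟩
    have : ((q.num.natAbs : ℕ) : ℝ) * (1 / (q.den : ℝ)) = q := by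
      rw [hqv, Nat.cast_natAbs, abs_of_nonneg h0]; ring
    simp only [this]
    exact ⟨hq1, hq2⟩
  · refine ⟨q.num.natAbs, ⟨_, Or.inr ⟨_, hmem, rfl⟩⟩, ?_⟩
    have : ((q.num.natAbs : ℕ) : ℝ) * -(1 / (q.den : ℝ)) = q := by
      rw [hqv, Nat.cast_natAbs, abs_of_nonpos h0]; push_cast; ring
    simp only [this]
    exact ⟨hq1, hq2⟩

namespace Label

open Classical in
/-- A label agreeing with `s₀` on the window `[-N, N]` and with the translate of `s₁` on the window
`[n - N, n + N]`; in between, `L` steps of size `e` are made. -/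
noncomputable def splice (s₀ s₁ : Label) (N n L : ℤ) (e : symmSeqSet) : Label :=
  (fun i => if -N ≤ i ∧ i ≤ N then s₀.1 i else if n - N ≤ i ∧ i ≤ n + N then s₁.1 (i - n)
    else ⟨0, zero_mem_seqSet⟩,
  fun i => if -N ≤ i ∧ i ≤ N then s₀.2 i else if n - N ≤ i ∧ i ≤ n + N then s₁.2 (i - n)
    else if N + 1 ≤ i ∧ i < N + 1 + L then e else ⟨0, zero_mem_symmSeqSet⟩)

variable {s₀ s₁ : Label} {N n L : ℤ} {e : symmSeqSet}

lemma splice_fst_left {i : ℤ} (h : -N ≤ i ∧ i ≤ N) :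
    (splice s₀ s₁ N n L e).1 i = s₀.1 i := if_pos h

lemma splice_snd_left {i : ℤ} (h : -N ≤ i ∧ i ≤ N) :
    (splice s₀ s₁ N n L e).2 i = s₀.2 i := if_pos h

lemma splice_fst_right (hn : 2 * N + L + 1 ≤ n) (hL : 0 ≤ L) {i : ℤ}
    (h : n - N ≤ i ∧ i ≤ n + N) : (splice s₀ s₁ N n L e).1 i = s₁.1 (i - n) := by
  simp only [splice]
  rw [if_neg (by omega), if_pos h]

lemma splice_snd_right (hn : 2 * N + L + 1 ≤ n) (hL : 0 ≤ L) {i : ℤ}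
    (h : n - N ≤ i ∧ i ≤ n + N) : (splice s₀ s₁ N n L e).2 i = s₁.2 (i - n) := by
  simp only [splice]
  rw [if_neg (by omega), if_pos h]

lemma growth_splice_left (hN : 0 ≤ N) {k : ℤ} (h1 : -N ≤ k) (h2 : k ≤ N + 1) :
    (splice s₀ s₁ N n L e).growth k = s₀.growth k := by
  have key := signedSum_sub_of_eqOn (w₁ := fun i => ((splice s₀ s₁ N n L e).2 i : ℝ))
    (w₂ := fun i => (s₀.2 i : ℝ)) (n := 0) (a := -N) (b := N + 1)
    (fun i hi hi' => by simp only [sub_zero]; rw [splice_snd_left ⟨hi, by omega⟩])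
  have e1 := key k h1 h2
  have e2 := key 0 (by omega) (by omega)
  simp only [sub_zero, signedSum_zero] at e1 e2
  unfold growth
  linarith

lemma growth_splice_const (hN : 0 ≤ N) (hL : 0 ≤ L) (hn : 2 * N + L + 1 ≤ n) {a b : ℤ}
    (h : b ≤ -N ∨ (N + 1 + L ≤ a ∧ b ≤ n - N) ∨ n + N + 1 ≤ a) (hab : a ≤ b) :
    (splice s₀ s₁ N n L e).growth b = (splice s₀ s₁ N n L e).growth a := by
  have := signedSum_sub_of_const (w := fun i => ((splice s₀ s₁ N n L e).2 i : ℝ)) (e := 0)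
    (a := a) (b := b) (fun i hi hi' => by
      simp only [splice]
      rw [if_neg (by omega), if_neg (by omega), if_neg (by omega)]) b hab le_rfl
  unfold growth
  linarith

lemma growth_splice_word (hN : 0 ≤ N) (hn : 2 * N + L + 1 ≤ n) {k : ℤ}
    (h1 : N + 1 ≤ k) (h2 : k ≤ N + 1 + L) :
    (splice s₀ s₁ N n L e).growth k = s₀.growth (N + 1) + (k - (N + 1)) * e := by
  have := signedSum_sub_of_const (w := fun i => ((splice s₀ s₁ N n L e).2 i : ℝ)) (e := e)
    (a := N + 1) (b := N + 1 + L) (fun i hi hi' => by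
      simp only [splice]
      rw [if_neg (by omega), if_neg (by omega), if_pos (by omega)]) k h1 h2
  rw [← growth_splice_left (s₁ := s₁) (n := n) (L := L) (e := e) hN (k := N + 1) (by omega) le_rfl]
  unfold growth
  push_cast at this
  linarith

lemma growth_splice_start (hN : 0 ≤ N) (hL : 0 ≤ L) (hn : 2 * N + L + 1 ≤ n) :
    (splice s₀ s₁ N n L e).growth (n - N) = s₀.growth (N + 1) + L * e := by
  rw [growth_splice_const hN hL hn (a := N + 1 + L) (by omega) (by omega),
    growth_splice_word hN hn (by omega) le_rfl]
  push_cast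
  ring

lemma growth_splice_right (hN : 0 ≤ N) (hL : 0 ≤ L) (hn : 2 * N + L + 1 ≤ n) {k : ℤ}
    (h1 : -N ≤ k) (h2 : k ≤ N + 1) : (splice s₀ s₁ N n L e).growth (n + k) =
      s₀.growth (N + 1) + L * e + s₁.growth k - s₁.growth (-N) := by
  have key := signedSum_sub_of_eqOn (w₁ := fun i => ((splice s₀ s₁ N n L e).2 i : ℝ))
    (w₂ := fun i => (s₁.2 i : ℝ)) (n := n) (a := n - N) (b := n + N + 1)
    (fun i hi hi' => by rw [splice_snd_right hn hL ⟨hi, by omega⟩]) (n + k) (by omega) (by omega)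
  rw [← growth_splice_start (s₁ := s₁) (e := e) hN hL hn]
  have e1 : n + k - n = k := by ring
  have e2 : n - N - n = -N := by ring
  rw [e1, e2] at key
  unfold growth
  linarith

lemma growth_splice_le (hN : 0 ≤ N) (hL : 0 ≤ L) (hn : 2 * N + L + 1 ≤ n) (k : ℤ) :
    (∃ j, -N ≤ j ∧ j ≤ N + 1 ∧ (splice s₀ s₁ N n L e).growth k ≤ s₀.growth j) ∨
    (∃ j, -N ≤ j ∧ j ≤ N + 1 ∧ (splice s₀ s₁ N n L e).growth k ≤
      s₀.growth (N + 1) + L * e + s₁.growth j - s₁.growth (-N)) := by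
  rcases le_total k (-N) with h1 | h1
  · refine Or.inl ⟨-N, le_rfl, by omega, ?_⟩
    rw [← growth_splice_const hN hL hn (Or.inl le_rfl) h1,
      growth_splice_left hN le_rfl (by omega)]
  rcases le_total k (N + 1) with h2 | h2
  · exact Or.inl ⟨k, h1, h2, (growth_splice_left hN h1 h2).le⟩
  rcases le_total k (N + 1 + L) with h3 | h3
  · rw [growth_splice_word hN hn h2 h3]
    have hk : ((N + 1 : ℤ) : ℝ) ≤ k := by exact_mod_cast h2
    have hk' : (k : ℝ) ≤ ((N + 1 + L : ℤ) : ℝ) := by exact_mod_cast h3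
    push_cast at hk hk'
    rcases le_total (e : ℝ) 0 with he | he
    · exact Or.inl ⟨N + 1, by omega, le_rfl, by nlinarith⟩
    · exact Or.inr ⟨-N, le_rfl, by omega, by nlinarith⟩
  rcases le_total k (n - N) with h4 | h4
  · refine Or.inr ⟨-N, le_rfl, by omega, ?_⟩
    rw [← growth_splice_const hN hL hn (b := n - N) (Or.inr (Or.inl ⟨h3, le_rfl⟩)) h4,
      growth_splice_start hN hL hn]
    linarith
  rcases le_total k (n + N + 1) with h5 | h5
  · refine Or.inr ⟨k - n, by omega, by omega, ?_⟩
    rw [← growth_splice_right hN hL hn (by omega) (by omega)]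
    rw [show n + (k - n) = k by ring]
  · refine Or.inr ⟨N + 1, by omega, le_rfl, ?_⟩
    rw [growth_splice_const hN hL hn (Or.inr (Or.inr le_rfl)) h5, add_assoc n N 1,
      growth_splice_right hN hL hn (by omega) le_rfl]

end Label

namespace Base

/-- A basic neighbourhood inside an open set. -/
lemma exists_window {O : Set (ℝ × Label)} (hO : IsOpen O) {p : ℝ × Label} (hp : p ∈ O) :
    ∃ N : ℕ, ∃ ε > 0, ∀ (t : ℝ) (s : Label), |t - p.1| < ε →
      (∀ k : ℤ, -N ≤ k → k ≤ N → s.1 k = p.2.1 k ∧ s.2 k = p.2.2 k) → (t, s) ∈ O := by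
  by_contra! hcon
  choose t s ht hs hO' using fun N : ℕ => hcon N (1 / ((N : ℝ) + 1)) (by positivity)
  have hev : ∀ k : ℤ, ∀ᶠ N : ℕ in atTop, (s N).1 k = p.2.1 k ∧ (s N).2 k = p.2.2 k := fun k => by
    filter_upwards [eventually_ge_atTop k.natAbs] with N hN
    exact hs N k (by omega) (by omega)
  have h1 : Tendsto t atTop (𝓝 p.1) := by
    rw [tendsto_iff_dist_tendsto_zero]
    exact squeeze_zero (fun _ => dist_nonneg) (fun N => (Real.dist_eq _ _ ▸ (ht N).le))
      tendsto_one_div_add_atTop_nhds_zero_nat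
  have h2 : Tendsto (fun N => (s N).1) atTop (𝓝 p.2.1) := tendsto_pi_nhds.mpr fun k =>
    tendsto_const_nhds.congr' ((hev k).mono fun N h => h.1.symm)
  have h3 : Tendsto (fun N => (s N).2) atTop (𝓝 p.2.2) := tendsto_pi_nhds.mpr fun k =>
    tendsto_const_nhds.congr' ((hev k).mono fun N h => h.2.symm)
  have h4 : Tendsto (fun N => (t N, s N)) atTop (𝓝 p) :=
    h1.prodMk_nhds (h2.prodMk_nhds h3)
  obtain ⟨N, hN⟩ := (h4.eventually (hO.mem_nhds hp)).exists
  exact hO' N hN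

/-- The height of a point may be changed slightly so that the defining inequalities become strict
on a window. -/
lemma exists_strict {p : ℝ × Label} (hp : p ∈ Base) (N : ℕ) {ε : ℝ} (hε : 0 < ε) :
    ∃ τ > 0, |τ - p.1| < ε ∧
      ∀ k : ℤ, -N ≤ k → k ≤ N + 1 → τ * Real.exp (p.2.growth k) < 1 := by
  obtain ⟨M, hM⟩ := ((Finset.Icc (-N : ℤ) (N + 1)).image
    fun k => Real.exp (p.2.growth k)).exists_le
  have hM' : ∀ k : ℤ, -N ≤ k → k ≤ N + 1 → Real.exp (p.2.growth k) ≤ M := fun k h1 h2 =>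
    hM _ (Finset.mem_image_of_mem _ (Finset.mem_Icc.mpr ⟨h1, h2⟩))
  have hM0 : 0 < M := (Real.exp_pos _).trans_le (hM' 0 (by omega) (by omega))
  set c : ℝ := 1 / (2 * M) with hc
  have hc0 : 0 < c := by positivity
  set η : ℝ := ε / (ε + |c - p.1| + 1) with hη
  have hden : 0 < ε + |c - p.1| + 1 := by positivity
  have hη0 : 0 < η := by positivity
  have hη1 : η < 1 := by
    rw [hη, div_lt_one hden]
    linarith [abs_nonneg (c - p.1)]
  refine ⟨(1 - η) * p.1 + η * c, ?_, ?_, fun k h1 h2 => ?_⟩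
  · have := hp.1
    have := mul_pos hη0 hc0
    nlinarith
  · rw [show (1 - η) * p.1 + η * c - p.1 = η * (c - p.1) by ring, abs_mul, abs_of_pos hη0, hη,
      div_mul_eq_mul_div, div_lt_iff₀ hden]
    nlinarith
  · have e1 := hp.2 k
    have e2 : c * Real.exp (p.2.growth k) ≤ 1 / 2 := by
      rw [hc, div_mul_eq_mul_div, div_le_div_iff₀ (by positivity) (by positivity)]
      linarith [hM' k h1 h2]
    nlinarith

/-- The skew shift on the base space is topologically mixing. -/
lemma mixing : TopologicallyMixing (next 1) := by
  intro U V hU hV ⟨p, hp⟩ ⟨p', hp'⟩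
  obtain ⟨O, hO, rfl⟩ := isOpen_induced_iff.mp hU
  obtain ⟨O', hO', rfl⟩ := isOpen_induced_iff.mp hV
  obtain ⟨N₀, ε₀, hε₀, hw₀⟩ := exists_window hO hp
  obtain ⟨N₁, ε₁, hε₁, hw₁⟩ := exists_window hO' hp'
  set N := max N₀ N₁ with hN
  obtain ⟨τ₀, hτ₀, hd₀, hs₀⟩ := exists_strict p.2 N hε₀
  obtain ⟨τ₁, hτ₁, hd₁, hs₁⟩ := exists_strict p'.2 N (half_pos hε₁)
  set b := Real.log (τ₁ / τ₀) + p'.1.2.growth (-N) - p.1.2.growth (N + 1) with hb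
  have hmin : 0 < min (1 / 2 : ℝ) (ε₁ / (2 * τ₁)) := lt_min (by norm_num) (by positivity)
  have hlog : Real.log (1 - min (1 / 2) (ε₁ / (2 * τ₁))) < 0 :=
    Real.log_neg (by linarith [min_le_left (1 / 2 : ℝ) (ε₁ / (2 * τ₁))])
      (by linarith)
  obtain ⟨L, e, hL1, hL2⟩ := exists_mul_mem_Ioo
    (show b + Real.log (1 - min (1 / 2) (ε₁ / (2 * τ₁))) < b by linarith)
  refine ⟨2 * N + L + 1, fun n hn => ?_⟩
  set s := Label.splice p.1.2 p'.1.2 N n L e with hs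
  have hN0 : (0 : ℤ) ≤ N := by omega
  have hL0 : (0 : ℤ) ≤ L := by omega
  have hn' : 2 * (N : ℤ) + L + 1 ≤ n := by omega
  have hval : ∀ x : ℝ, τ₀ * Real.exp (p.1.2.growth (N + 1) + L * e + x - p'.1.2.growth (-N))
      = τ₁ * Real.exp (L * e - b) * Real.exp x := fun x => by
    have h1 : τ₁ = τ₀ * Real.exp (Real.log (τ₁ / τ₀)) := by
      rw [Real.exp_log (by positivity)]
      field_simp
    nth_rewrite 1 [h1]
    rw [mul_assoc, mul_assoc, ← Real.exp_add, ← Real.exp_add]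
    congr 2
    rw [hb]; ring
  have hle : Real.exp (L * e - b) < 1 := Real.exp_lt_one_iff.mpr (by linarith)
  have hge : 1 - min (1 / 2) (ε₁ / (2 * τ₁)) < Real.exp (L * e - b) := by
    rw [← Real.log_lt_iff_lt_exp]
    · linarith
    · linarith [min_le_left (1 / 2 : ℝ) (ε₁ / (2 * τ₁))]
  have hmem : (τ₀, s) ∈ Base := by
    refine ⟨hτ₀.le, fun k => ?_⟩
    rcases Label.growth_splice_le (s₀ := p.1.2) (s₁ := p'.1.2) (e := e) hN0 hL0 hn' k with
      ⟨j, hj1, hj2, hj⟩ | ⟨j, hj1, hj2, hj⟩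
    · exact (mul_le_mul_of_nonneg_left (Real.exp_le_exp.mpr hj) hτ₀.le).trans (hs₀ j hj1 hj2).le
    · refine (mul_le_mul_of_nonneg_left (Real.exp_le_exp.mpr hj) hτ₀.le).trans ?_
      rw [Int.cast_natCast, hval]
      refine le_trans ?_ (hs₁ j hj1 hj2).le
      refine mul_le_mul_of_nonneg_right ?_ (Real.exp_nonneg _)
      nlinarith
  refine ⟨next n ⟨_, hmem⟩, ⟨⟨_, hmem⟩, ?_, next_iterate n _⟩, ?_⟩
  · refine hw₀ τ₀ s hd₀ fun k h1 h2 => ?_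
    have h : -(N : ℤ) ≤ k ∧ k ≤ N := by omega
    exact ⟨Label.splice_fst_left h, Label.splice_snd_left h⟩
  · refine hw₁ _ _ ?_ fun k h1 h2 => ?_
    · have := Label.growth_splice_right (s₀ := p.1.2) (s₁ := p'.1.2) (e := e) hN0 hL0 hn' (k := 0)
        (by omega) (by omega)
      rw [add_zero, Label.growth_zero] at this
      simp only [hs]
      rw [this, Int.cast_natCast, hval, Real.exp_zero, mul_one]
      have h1 : ε₁ / (2 * τ₁) * τ₁ = ε₁ / 2 := by field_simp
      have h2 := min_le_right (1 / 2 : ℝ) (ε₁ / (2 * τ₁))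
      rw [abs_lt] at hd₁ ⊢
      constructor <;> nlinarith
    · have h : (n : ℤ) - N ≤ k + n ∧ k + n ≤ n + N := by omega
      have e1 := Label.splice_fst_right (s₀ := p.1.2) (s₁ := p'.1.2) (e := e) hn' hL0 h
      have e2 := Label.splice_snd_right (s₀ := p.1.2) (s₁ := p'.1.2) (e := e) hn' hL0 h
      rw [add_sub_cancel_right] at e1 e2
      exact ⟨e1, e2⟩

/-- The points touching the upper bound somewhere along their orbits are dense. -/
lemma exists_touching {U : Set Base} (hU : IsOpen U) (hne : U.Nonempty) :
    ∃ p ∈ U, ∃ k, p.1.1 * Real.exp (p.1.2.growth k) = 1 := by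
  obtain ⟨p, hp⟩ := hne
  obtain ⟨O, hO, rfl⟩ := isOpen_induced_iff.mp hU
  obtain ⟨N, ε, hε, hw⟩ := exists_window hO hp
  obtain ⟨τ, hτ, hd, hs⟩ := exists_strict p.2 N (half_pos hε)
  set a := p.1.2.growth (N + 1)
  have hmin : 0 < min (1 / 2 : ℝ) (ε / (2 * τ)) := lt_min (by norm_num) (by positivity)
  have hlog : Real.log (1 - min (1 / 2) (ε / (2 * τ))) < 0 :=
    Real.log_neg (by linarith [min_le_left (1 / 2 : ℝ) (ε / (2 * τ))])
      (by linarith)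
  obtain ⟨L, e, hL1, hL2⟩ := exists_mul_mem_Ioo (show -Real.log τ - a <
    -Real.log τ - a - Real.log (1 - min (1 / 2) (ε / (2 * τ))) by linarith)
  set s₁ : Label := (fun _ => ⟨0, zero_mem_seqSet⟩, fun _ => ⟨0, zero_mem_symmSeqSet⟩)
  have hs₁ : ∀ k, s₁.growth k = 0 := signedSum_eq_zero fun _ => rfl
  set n : ℤ := 2 * N + L + 1
  set s := Label.splice p.1.2 s₁ N n L e with hsdef
  have hN0 : (0 : ℤ) ≤ N := by omega
  have hL0 : (0 : ℤ) ≤ L := by omega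
  set t := Real.exp (-(a + L * e)) with ht
  have ht0 : 0 < t := Real.exp_pos _
  have htτ : t < τ := by
    rw [ht, ← Real.lt_log_iff_exp_lt hτ]
    linarith
  have htτ' : τ * (1 - min (1 / 2) (ε / (2 * τ))) < t := by
    have h0 : 0 < 1 - min (1 / 2) (ε / (2 * τ)) := by
      linarith [min_le_left (1 / 2 : ℝ) (ε / (2 * τ))]
    rw [ht, ← Real.log_lt_iff_lt_exp (by positivity), Real.log_mul hτ.ne' h0.ne']
    linarith
  have htouch : t * Real.exp (a + L * e) = 1 := by
    rw [ht, ← Real.exp_add]; simp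
  have hmem : (t, s) ∈ Base := by
    refine ⟨ht0.le, fun k => ?_⟩
    rcases Label.growth_splice_le (s₀ := p.1.2) (s₁ := s₁) (e := e) hN0 hL0 (n := n) le_rfl k with
      ⟨j, hj1, hj2, hj⟩ | ⟨j, hj1, hj2, hj⟩
    · refine (mul_le_mul htτ.le (Real.exp_le_exp.mpr hj) (Real.exp_nonneg _) hτ.le).trans
        (hs j hj1 hj2).le
    · rw [hs₁, hs₁, add_zero, sub_zero] at hj
      exact (mul_le_mul_of_nonneg_left (Real.exp_le_exp.mpr hj) ht0.le).trans htouch.le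
  refine ⟨⟨_, hmem⟩, hw t s ?_ fun k h1 h2 => ?_, n - N, ?_⟩
  · have h1 : ε / (2 * τ) * τ = ε / 2 := by field_simp
    have h2 := min_le_right (1 / 2 : ℝ) (ε / (2 * τ))
    rw [abs_lt] at hd ⊢
    constructor <;> nlinarith
  · have h : -(N : ℤ) ≤ k ∧ k ≤ N := by omega
    exact ⟨Label.splice_fst_left h, Label.splice_snd_left h⟩
  · rw [← htouch]
    congr 2
    exact Label.growth_splice_start hN0 hL0 le_rfl

end Base

namespace FoldData

variable (d : FoldData)

lemma mixing_map : TopologicallyMixing (d.map 1) := by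
  intro U V hU hV hUne hVne
  obtain ⟨n₀, h⟩ := Base.mixing _ _ (hU.preimage d.continuous_proj) (hV.preimage d.continuous_proj)
    (hUne.preimage d.surjective_proj) (hVne.preimage d.surjective_proj)
  refine ⟨n₀, fun n hn => ?_⟩
  obtain ⟨_, ⟨p, hp, rfl⟩, hV⟩ := h n hn
  refine ⟨_, ⟨_, hp, rfl⟩, ?_⟩
  rw [d.map_iterate, ← Base.next_iterate]
  exact hV

lemma mem_dendroidEndpoints {p : Base} {k : ℤ} (h : p.1.1 * Real.exp (p.1.2.growth k) = 1) :
    d.proj p ∈ DendroidEndpoints d.Space := by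
  have hp : 0 < p.1.1 := p.2.1.lt_of_ne fun h0 => by simp [← h0] at h
  refine d.chart.mem_dendroidEndpoints (d.proj_ne_top.mpr hp) fun y hy hl => ?_
  obtain ⟨q, rfl⟩ := d.surjective_proj y
  have hq := d.proj_ne_top.mp hy
  change d.label (d.proj q) = d.label (d.proj p) at hl
  change d.height (d.label (d.proj p)) _ ≤ d.height (d.label (d.proj p)) _
  rw [d.label_proj hp] at hl ⊢
  rw [d.label_proj hq] at hl
  have hqp : q.1.1 ≤ p.1.1 := by
    have := q.2.2 k
    rw [hl, ← h] at this
    exact le_of_mul_le_mul_right this (Real.exp_pos _)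
  by_cases hs : p.1.2.IsFixed
  · rw [d.height_of_isFixed hs, d.height_of_isFixed hs]
    rw [hs.growth, Real.exp_zero, mul_one] at h
    have : d.foldHeight p = 1 := by rw [foldHeight, h, d.fold_one (p.1.2.1 0).2]
    rw [this]
    exact d.fold_le_one (q.1.2.1 0).2 (Base.le_one q.2)
  · obtain ⟨j, hj, hh⟩ := d.height_of_not_isFixed hs
    rw [hh, hh, hl]
    exact mul_le_mul_of_nonneg_right hqp hj.le

lemma isLelekLikeFan : IsLelekLikeFan d.Space := by
  refine ⟨d.chart.isFan, dense_iff_inter_open.mpr fun U hU hne => ?_⟩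
  obtain ⟨p, hp, k, hk⟩ := Base.exists_touching (hU.preimage d.continuous_proj)
    (hne.preimage d.surjective_proj)
  exact ⟨d.proj p, hp, d.mem_dendroidEndpoints hk⟩

end FoldData

namespace Label

/-- The label constantly equal to `z` with all steps `0`. -/
def const (z : seqSet) : Label := (fun _ => z, fun _ => ⟨0, zero_mem_symmSeqSet⟩)

lemma isFixed_const (z : seqSet) : (const z).IsFixed := isFixed_iff.mpr fun _ => ⟨rfl, rfl⟩

lemma IsFixed.eq_const {s : Label} (h : s.IsFixed) : s = const (s.1 0) := by
  rw [isFixed_iff] at h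
  exact Prod.ext (funext fun k => (h k).1) (funext fun k => Subtype.ext (h k).2)

lemma continuous_const : Continuous const :=
  (continuous_pi fun _ => continuous_id).prodMk _root_.continuous_const

lemma isClosed_isFixed : IsClosed {s : Label | s.IsFixed} := by
  have : {s : Label | s.IsFixed} = ⋂ k, {s | s.defect k = 0} := by ext; simp [IsFixed]
  rw [this]
  exact isClosed_iInter fun k => isClosed_eq (continuous_defect k) _root_.continuous_const

end Label

lemma exists_eq_of_pos {z : seqSet} (hz : 0 < (z : ℝ)) :
    ∃ n : ℕ, z = ⟨1 / ((n : ℝ) + 1), mem_seqSet n⟩ := by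
  rcases z.2 with h | ⟨n, hn⟩
  · exact absurd h hz.ne'
  · exact ⟨n, Subtype.ext hn.symm⟩

namespace FoldData

variable (d : FoldData)

lemma le_proj_iff {p q : Base} : d.chart.le (d.proj p) (d.proj q) ↔
    p.1.1 = 0 ∨ (0 < p.1.1 ∧ 0 < q.1.1 ∧ p.1.2 = q.1.2 ∧
      d.height q.1.2 (d.proj p) ≤ d.height q.1.2 (d.proj q)) := by
  refine or_congr d.proj_eq_top ?_
  change (d.proj p ≠ d.top ∧ d.proj q ≠ d.top ∧ d.label (d.proj p) = d.label (d.proj q) ∧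
    d.height (d.label (d.proj q)) _ ≤ d.height (d.label (d.proj q)) _) ↔ _
  rw [proj_ne_top, proj_ne_top]
  refine and_congr_right fun hp => and_congr_right fun hq => ?_
  rw [d.label_proj hp, d.label_proj hq]

lemma le_proj_of_not_isFixed {p q : Base} (hs : ¬ q.1.2.IsFixed) (hpq : p.1.2 = q.1.2)
    (hp : 0 < p.1.1) (hq : 0 < q.1.1) : d.chart.le (d.proj p) (d.proj q) ↔ p.1.1 ≤ q.1.1 := by
  obtain ⟨k, hk, h⟩ := d.height_of_not_isFixed hs
  rw [le_proj_iff, h, h, hpq, mul_le_mul_iff_left₀ hk]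
  simp [hp, hq, hp.ne']

lemma le_proj_of_isFixed {p q : Base} (hs : q.1.2.IsFixed) (hpq : p.1.2 = q.1.2)
    (hp : 0 < p.1.1) (hq : 0 < q.1.1) :
    d.chart.le (d.proj p) (d.proj q) ↔ d.foldHeight p ≤ d.foldHeight q := by
  rw [le_proj_iff, d.height_of_isFixed hs, d.height_of_isFixed hs]
  simp [hp, hq, hp.ne', hpq]

/-- The closure of the order is contained in the image of the closed order of the base space. -/
lemma exists_of_mem_closure_le {x y : d.Space}
    (h : (x, y) ∈ closure {p : d.Space × d.Space | d.chart.le p.1 p.2}) :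
    ∃ p q : Base, p.1.1 ≤ q.1.1 ∧ p.1.2 = q.1.2 ∧ d.proj p = x ∧ d.proj q = y := by
  set T : Set (d.Space × d.Space) :=
    (Prod.map d.proj d.proj) '' {a : Base × Base | a.1.1.1 ≤ a.2.1.1 ∧ a.1.1.2 = a.2.1.2} with hT
  have hcl : IsClosed T := by
    refine (d.continuous_proj.prodMap d.continuous_proj).isClosedMap _ ?_
    have c1 : Continuous fun a : Base × Base => a.1.1.1 := by fun_prop
    have c2 : Continuous fun a : Base × Base => a.2.1.1 := by fun_prop
    have c3 : Continuous fun a : Base × Base => a.1.1.2 := by fun_prop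
    have c4 : Continuous fun a : Base × Base => a.2.1.2 := by fun_prop
    exact (isClosed_le c1 c2).inter (isClosed_eq c3 c4)
  have hsub : {p : d.Space × d.Space | d.chart.le p.1 p.2} ⊆ T := by
    rintro ⟨x, y⟩ hxy
    obtain ⟨p, rfl⟩ := d.surjective_proj x
    obtain ⟨q, rfl⟩ := d.surjective_proj y
    rcases d.le_proj_iff.mp hxy with h0 | ⟨hp, hq, hl, -⟩
    · refine ⟨(⟨(0, q.1.2), Base.zero_mem _⟩, q), ⟨q.2.1, rfl⟩, ?_⟩
      refine Prod.ext (d.proj_eq_iff.mpr (Or.inl ⟨rfl, h0⟩)) rfl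
    · rcases le_or_gt p.1.1 q.1.1 with hle | hlt
      · exact ⟨(p, q), ⟨hle, hl⟩, rfl⟩
      · by_cases hs : q.1.2.IsFixed
        · have hh := (d.le_proj_of_isFixed hs hl hp hq).mp hxy
          have hc : ContinuousOn (fun t => d.foldHeight (t, q.1.2)) (Icc 0 q.1.1) := by fun_prop
          obtain ⟨t, ht, htr⟩ := intermediate_value_Icc q.2.1 hc
            ⟨by
              rw [d.foldHeight_eq_zero (p := (0, q.1.2)) rfl]
              exact ((d.fold_pos p.2).mpr hp).le, hh⟩
          refine ⟨(⟨(t, q.1.2), Base.mem_of_le q.2 ht.1 ht.2⟩, q), ⟨ht.2, rfl⟩, ?_⟩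
          exact Prod.ext (d.proj_eq_iff.mpr (Or.inr ⟨hl.symm, Or.inr ⟨hs, htr⟩⟩)) rfl
        · exact absurd ((d.le_proj_of_not_isFixed hs hl hp hq).mp hxy) (not_le.mpr hlt)
  obtain ⟨⟨p, q⟩, ⟨h1, h2⟩, h3⟩ := closure_minimal hsub hcl h
  exact ⟨p, q, h1, h2, congrArg Prod.fst h3, congrArg Prod.snd h3⟩

/-- The points of the base space which may be projected to points of non-smoothness. -/
def foldZone : Set Base := {p | 0 < p.1.1 ∧ p.1.2.IsFixed ∧ 0 < (p.1.2.1 0 : ℝ) ∧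
  |d.foldHeight p - d.pos (p.1.2.1 0)| ≤ p.1.2.1 0}

lemma nonsmooth_subset : d.chart.nonsmooth ⊆ d.proj '' d.foldZone := by
  rintro x ⟨z, hz, hzx⟩
  obtain ⟨p, q, hpq, hl, rfl, rfl⟩ := d.exists_of_mem_closure_le hz
  have hp : 0 < p.1.1 := p.2.1.lt_of_ne fun h => hzx (d.le_proj_iff.mpr (Or.inl h.symm))
  have hq := hp.trans_le hpq
  by_cases hs : q.1.2.IsFixed
  · rw [d.le_proj_of_isFixed hs hl hp hq, not_le, foldHeight, foldHeight, hl] at hzx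
    have := d.of_fold_lt (q.1.2.1 0).2 hpq hzx
    exact ⟨q, ⟨hq, hs, this.1, this.2⟩, rfl⟩
  · rw [d.le_proj_of_not_isFixed hs hl hp hq] at hzx
    exact absurd hpq hzx

/-- The point of the base space at height `t` with a constant label. -/
def constPoint (z : seqSet) (t : Icc (0 : ℝ) 1) : Base :=
  ⟨(t, Label.const z), Base.mem_of_isFixed (Label.isFixed_const z) t.2.1 t.2.2⟩

lemma continuous_constPoint : Continuous fun a : seqSet × Icc (0 : ℝ) 1 => constPoint a.1 a.2 := by
  unfold constPoint
  have := Label.continuous_const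
  fun_prop

lemma pos_add_size_mem (z : seqSet) : d.pos z + d.size z ∈ Icc (0 : ℝ) 1 := by
  obtain ⟨h0, h1⟩ := seqSet_bounds z.2
  have := d.size_le_pos h1
  have := d.pos_le z
  have := d.pos_pos z
  have := d.size_nonneg h0
  constructor <;> linarith

lemma nonsmooth_constPoint {z : seqSet} (hz : 0 < (z : ℝ)) :
    d.proj (constPoint z ⟨_, d.pos_add_size_mem z⟩) ∈ d.chart.nonsmooth := by
  obtain ⟨h0, h1⟩ := seqSet_bounds z.2
  have hpos := d.pos_pos z
  have hsize := d.size_pos hz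
  have hmem := d.pos_add_size_mem z
  have hmem' : d.pos z ∈ Icc (0 : ℝ) 1 := ⟨hpos.le, by linarith [d.pos_le z]⟩
  refine ⟨d.proj (constPoint z ⟨_, hmem'⟩), ?_, ?_⟩
  · set s : ℕ → Label := fun m => (Function.update (fun _ => z) (m + 1 : ℤ) ⟨0, zero_mem_seqSet⟩,
      fun _ => ⟨0, zero_mem_symmSeqSet⟩)
    have hgrowth : ∀ m k, (s m).growth k = 0 := fun m k => signedSum_eq_zero (fun _ => rfl) k
    have hbase : ∀ m, ∀ t ∈ Icc (0 : ℝ) 1, (t, s m) ∈ Base := fun m t ht =>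
      ⟨ht.1, fun k => by simpa [hgrowth] using ht.2⟩
    have hs : ∀ m, ¬ (s m).IsFixed := fun m h => by
      have := (Label.isFixed_iff.mp h (m + 1)).1
      simp only [s, Function.update_self] at this
      rw [Function.update_of_ne (by omega)] at this
      exact hz.ne (congrArg Subtype.val this)
    have hlim : Tendsto s atTop (𝓝 (Label.const z)) := by
      refine Tendsto.prodMk_nhds (tendsto_pi_nhds.mpr fun k => ?_) tendsto_const_nhds
      refine tendsto_const_nhds.congr' ?_
      filter_upwards [eventually_ge_atTop k.natAbs] with m hm
      have hk : k ≠ (m : ℤ) + 1 := by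
        have : k.natAbs ≤ m := hm
        omega
      exact (Function.update_of_ne hk (⟨0, zero_mem_seqSet⟩ : seqSet) fun _ => z).symm
    have hlim' : ∀ (t : ℝ) (ht : t ∈ Icc (0 : ℝ) 1), Tendsto (fun m => d.proj ⟨_, hbase m t ht⟩)
        atTop (𝓝 (d.proj (constPoint z ⟨t, ht⟩))) := fun t ht => by
      refine (d.continuous_proj.tendsto _).comp ?_
      rw [tendsto_subtype_rng]
      exact tendsto_const_nhds.prodMk_nhds hlim
    refine mem_closure_of_tendsto ((hlim' _ hmem').prodMk_nhds (hlim' _ hmem))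
      (Eventually.of_forall fun m => ?_)
    refine (d.le_proj_of_not_isFixed (p := ⟨_, hbase m _ hmem'⟩) (q := ⟨_, hbase m _ hmem⟩) (hs m)
      rfl hpos (add_pos hpos hsize)).mpr ?_
    change d.pos z ≤ d.pos z + d.size z
    linarith
  · rw [d.le_proj_of_isFixed (p := constPoint z ⟨_, hmem'⟩) (q := constPoint z ⟨_, hmem⟩)
      (Label.isFixed_const z) rfl hpos (add_pos hpos hsize)]
    change ¬ d.fold z (d.pos z) ≤ d.fold z (d.pos z + d.size z)
    rw [d.fold_of_near (by simpa using hsize.le), d.fold_of_far (t := d.pos z + d.size z)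
      (by rw [add_sub_cancel_left]; exact le_abs_self _)]
    rw [sub_self, abs_zero]
    linarith

/-- The limits of the positions of the folds. -/
def limitSet : Set ℝ := {r | 0 < r ∧ ∀ ε > 0, ∀ N : ℕ, ∃ n ≥ N, |d.pos (1 / ((n : ℝ) + 1)) - r| < ε}

lemma limitSet_subset : d.limitSet ⊆ Icc 0 1 := by
  rintro r ⟨h0, hr⟩
  obtain ⟨n, -, hn⟩ := hr (1 / 2) (by norm_num) 0
  have := d.pos_le (1 / ((n : ℝ) + 1))
  rw [abs_lt] at hn
  exact ⟨h0.le, by linarith⟩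

/-- The limit leg. -/
noncomputable def limitPoint (r : d.limitSet) : d.Space :=
  d.proj (constPoint ⟨0, zero_mem_seqSet⟩ ⟨r, d.limitSet_subset r.2⟩)

lemma foldHeight_constPoint_zero (t : Icc (0 : ℝ) 1) :
    d.foldHeight (constPoint ⟨0, zero_mem_seqSet⟩ t) = t := by
  change d.fold 0 t = t
  exact d.fold_of_far (by simp [size])

lemma le_limitPoint (r r' : d.limitSet) :
    d.chart.le (d.limitPoint r) (d.limitPoint r') ↔ (r : ℝ) ≤ r' := by
  rw [limitPoint, limitPoint, d.le_proj_of_isFixed (p := constPoint _ ⟨r, d.limitSet_subset r.2⟩)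
    (q := constPoint _ ⟨r', d.limitSet_subset r'.2⟩) (Label.isFixed_const _) rfl r.2.1 r'.2.1,
    foldHeight_constPoint_zero, foldHeight_constPoint_zero]

lemma limitPoint_mem (r : d.limitSet) : d.limitPoint r ∈ d.chart.limitNonsmooth := by
  refine ⟨d.proj_ne_top.mpr r.2.1, ?_, ?_⟩
  · choose n hn hr using fun j : ℕ => r.2.2 (1 / ((j : ℝ) + 1)) (by positivity) j
    set z : ℕ → seqSet := fun j => ⟨1 / ((n j : ℝ) + 1), mem_seqSet (n j)⟩ with hz
    have hz0 : Tendsto (fun j => (z j : ℝ)) atTop (𝓝 0) :=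
      tendsto_one_div_add_atTop_nhds_zero_nat.comp (tendsto_atTop_mono hn tendsto_id)
    have h1 : Tendsto z atTop (𝓝 ⟨0, zero_mem_seqSet⟩) := by
      rwa [tendsto_subtype_rng]
    have h2 : Tendsto (fun j => d.pos (z j)) atTop (𝓝 r) := by
      rw [tendsto_iff_dist_tendsto_zero]
      exact squeeze_zero (fun _ => dist_nonneg) (fun N => (Real.dist_eq _ _ ▸ (hr N).le))
        tendsto_one_div_add_atTop_nhds_zero_nat
    have h3 : Tendsto (fun j => d.size (z j)) atTop (𝓝 0) :=
      squeeze_zero (fun j => d.size_nonneg (seqSet_bounds (z j).2).1)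
        (fun j => by
          have := d.size_le (seqSet_bounds (z j).2).1
          have := d.size_nonneg (seqSet_bounds (z j).2).1
          linarith) hz0
    have h4 : Tendsto (fun j => (⟨_, d.pos_add_size_mem (z j)⟩ : Icc (0 : ℝ) 1)) atTop
        (𝓝 ⟨r, d.limitSet_subset r.2⟩) := by
      rw [tendsto_subtype_rng]
      simpa using h2.add h3
    have h5 := ((d.continuous_proj.comp continuous_constPoint).tendsto _).comp (h1.prodMk_nhds h4)
    refine mem_closure_of_tendsto h5 (Eventually.of_forall fun j => ?_)
    refine d.nonsmooth_constPoint ?_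
    simp only [hz]
    positivity
  · intro y hy
    obtain ⟨p, ⟨hp, -, hz, -⟩, rfl⟩ := d.nonsmooth_subset hy
    have hne : p.1.2 ≠ Label.const ⟨0, zero_mem_seqSet⟩ := fun h => by
      rw [h] at hz
      exact hz.false
    constructor
    · intro h
      rcases d.le_proj_iff.mp h with h | h
      · exact r.2.1.ne' h
      · exact hne h.2.2.1.symm
    · intro h
      rcases d.le_proj_iff.mp h with h | h
      · exact hp.ne' h
      · exact hne h.2.2.1

lemma exists_limitPoint {x : d.Space} (hx : x ∈ d.chart.limitNonsmooth) :
    ∃ r, d.limitPoint r = x := by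
  obtain ⟨hv, hcl, hno⟩ := hx
  obtain ⟨p, hp, rfl⟩ : x ∈ d.proj '' closure d.foldZone :=
    (d.continuous_proj.isClosedMap _ isClosed_closure).closure_subset_iff.mpr
      (d.nonsmooth_subset.trans (image_mono subset_closure)) hcl
  have hp0 := d.proj_ne_top.mp hv
  have hfix : p.1.2.IsFixed := by
    have : IsClosed {p : Base | p.1.2.IsFixed} :=
      Label.isClosed_isFixed.preimage (by fun_prop : Continuous fun p : Base => p.1.2)
    exact closure_minimal (fun q hq => hq.2.1) this hp
  rcases (seqSet_bounds (p.1.2.1 0).2).1.eq_or_lt with hz | hz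
  · have hz' : p.1.2.1 0 = ⟨0, zero_mem_seqSet⟩ := Subtype.ext hz.symm
    have hpc : p = constPoint ⟨0, zero_mem_seqSet⟩ ⟨p.1.1, p.2.1, Base.le_one p.2⟩ :=
      Subtype.ext (Prod.ext rfl (hfix.eq_const.trans (congrArg Label.const hz')))
    refine ⟨⟨p.1.1, hp0, fun ε hε N => ?_⟩, congrArg d.proj hpc.symm⟩
    have hh : d.foldHeight p = p.1.1 := by
      rw [hpc]; exact d.foldHeight_constPoint_zero _
    have c1 : Continuous fun q : Base => d.foldHeight q := by fun_prop
    have c2 : Continuous fun q : Base => (q.1.2.1 0 : ℝ) := by fun_prop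
    have e1 : ∀ᶠ q : Base in 𝓝 p, |d.foldHeight q - p.1.1| < ε / 2 := by
      have := (c1.tendsto p).eventually (Metric.ball_mem_nhds _ (half_pos hε))
      simpa [hh, Real.dist_eq] using this
    have e2 : ∀ᶠ q : Base in 𝓝 p, (q.1.2.1 0 : ℝ) < min (ε / 2) (1 / ((N : ℝ) + 1)) :=
      (c2.tendsto p).eventually_lt_const (by rw [← hz]; positivity)
    obtain ⟨q, ⟨hq0, hqf, hqz, hq⟩, hq1, hq2⟩ :=
      ((mem_closure_iff_frequently.mp hp).and_eventually (e1.and e2)).exists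
    obtain ⟨n, hn⟩ := exists_eq_of_pos hqz
    rw [lt_min_iff] at hq2
    rw [hn] at hq hq2
    refine ⟨n, ?_, ?_⟩
    · have := (one_div_lt_one_div (by positivity) (by positivity)).mp hq2.2
      have : (N : ℝ) < n := by linarith
      exact_mod_cast this.le
    · simp only at hq hq2
      rw [abs_le] at hq
      rw [abs_lt] at hq1 ⊢
      constructor <;> linarith
  · exfalso
    obtain ⟨h1, h2⟩ := hno _ (d.nonsmooth_constPoint hz)
    have hpos : 0 < d.pos (p.1.2.1 0) + d.size (p.1.2.1 0) :=
      add_pos (d.pos_pos _) (d.size_pos hz)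
    rw [d.le_proj_of_isFixed (Label.isFixed_const _) hfix.eq_const hp0 (by exact hpos)] at h1
    rw [d.le_proj_of_isFixed hfix hfix.eq_const.symm (by exact hpos) hp0] at h2
    exact h1 (le_of_not_ge h2)

/-- Homeomorphic fans have isomorphic limit sets. -/
lemma exists_orderIso {d d' : FoldData} (Φ : d.Space ≃ₜ d'.Space) :
    Nonempty (d.limitSet ≃o d'.limitSet) := by
  have hne : ∀ m n : ℕ, m ≠ n → Label.const ⟨1 / ((m : ℝ) + 1), mem_seqSet m⟩ ≠
      Label.const ⟨1 / ((n : ℝ) + 1), mem_seqSet n⟩ := fun m n hmn h => by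
    have := congrArg (fun s : Label => (s.1 0 : ℝ)) h
    simp only [Label.const, one_div, inv_inj] at this
    exact hmn (by exact_mod_cast add_right_cancel this)
  set x : ℕ → d.Space := fun n => d.proj (constPoint ⟨1 / ((n : ℝ) + 1), mem_seqSet n⟩
    ⟨1, zero_le_one, le_rfl⟩) with hxdef
  have hx : ∀ n, x n ≠ d.top := fun n => d.proj_ne_top.mpr one_pos
  have hl : ∀ m n, m ≠ n → d.label (x m) ≠ d.label (x n) := fun m n hmn => by
    simp only [hxdef]
    rw [d.label_proj (by exact one_pos), d.label_proj (by exact one_pos)]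
    exact hne m n hmn
  have hv : Φ d.chart.v = d'.chart.v := d.chart.map_top d'.chart Φ (hx 0) (hx 1) (hx 2)
    (hl 0 1 (by norm_num)) (hl 1 2 (by norm_num)) (hl 0 2 (by norm_num))
  have hL := d.chart.map_limitNonsmooth d'.chart Φ hv
  have hbij : ∀ d : FoldData, Function.Bijective fun r : d.limitSet =>
      (⟨d.limitPoint r, d.limitPoint_mem r⟩ : d.chart.limitNonsmooth) := fun d => by
    refine ⟨fun r r' h => ?_, fun x => ?_⟩
    · have h := congrArg Subtype.val h
      simp only at h
      refine Subtype.ext (le_antisymm ((d.le_limitPoint r r').mp ?_)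
        ((d.le_limitPoint r' r).mp ?_)) <;> rw [h, le_limitPoint]
    · obtain ⟨r, hr⟩ := d.exists_limitPoint x.2
      exact ⟨r, Subtype.ext hr⟩
  set E := Equiv.ofBijective _ (hbij d)
  set E' := Equiv.ofBijective _ (hbij d')
  set F : d.chart.limitNonsmooth ≃ d'.chart.limitNonsmooth :=
    Φ.toEquiv.subtypeEquiv fun a => (Set.ext_iff.mp hL a).symm
  set f := (E.trans F).trans E'.symm
  have hf : ∀ r, d'.limitPoint (f r) = Φ (d.limitPoint r) := fun r =>
    congrArg Subtype.val (E'.apply_symm_apply (F (E r)))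
  refine ⟨⟨f, fun {r r'} => ?_⟩⟩
  rw [← Subtype.coe_le_coe, ← le_limitPoint, hf, hf, d.chart.map_le d'.chart Φ hv, le_limitPoint,
    Subtype.coe_le_coe]

end FoldData

/-- The right end of the `k`-th component of `codeSet S`. -/
noncomputable def codeEnd (S : Set ℕ) (k : ℕ) : ℝ :=
  open Classical in (k : ℝ) + 2 + if k ∈ S then 1 / 2 else 0

/-- A union of intervals and points, where `S` determines which components are intervals. -/
def codeSet (S : Set ℕ) : Set ℝ := {r | 2 ≤ r ∧ ∀ k : ℕ, r ≤ codeEnd S k ∨ (k : ℝ) + 3 ≤ r}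

lemma le_codeEnd (S : Set ℕ) (k : ℕ) : (k : ℝ) + 2 ≤ codeEnd S k := by
  unfold codeEnd
  split_ifs <;> linarith

lemma codeEnd_lt (S : Set ℕ) (k : ℕ) : codeEnd S k < k + 3 := by
  unfold codeEnd
  split_ifs <;> linarith

lemma codeEnd_eq_iff {S : Set ℕ} {k : ℕ} : codeEnd S k = k + 2 ↔ k ∉ S := by
  unfold codeEnd
  split_ifs with h <;> simp [h]

lemma isClosed_codeSet (S : Set ℕ) : IsClosed (codeSet S) := by
  have : codeSet S = Ici 2 ∩ ⋂ k : ℕ, (Iic (codeEnd S k) ∪ Ici ((k : ℝ) + 3)) := by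
    ext r
    simp [codeSet]
  rw [this]
  exact isClosed_Ici.inter (isClosed_iInter fun k => isClosed_Iic.union isClosed_Ici)

lemma mem_codeSet {S : Set ℕ} {r : ℝ} :
    r ∈ codeSet S ↔ ∃ k : ℕ, (k : ℝ) + 2 ≤ r ∧ r ≤ codeEnd S k := by
  constructor
  · rintro ⟨h2, h⟩
    have h0 : 0 ≤ r - 2 := by linarith
    have h1 := Nat.floor_le h0
    have h3 := Nat.lt_floor_add_one (r - 2)
    refine ⟨⌊r - 2⌋₊, by linarith, (h _).resolve_right ?_⟩
    linarith
  · rintro ⟨k, h1, h2⟩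
    refine ⟨by have : (0 : ℝ) ≤ k := k.cast_nonneg
               linarith, fun j => ?_⟩
    rcases lt_or_ge j k with hj | hj
    · right
      have : (j : ℝ) + 1 ≤ k := by exact_mod_cast hj
      linarith
    · rcases hj.eq_or_lt with rfl | hj
      · exact Or.inl h2
      · left
        have : (k : ℝ) + 1 ≤ j := by exact_mod_cast hj
        linarith [codeEnd_lt S k, le_codeEnd S j]

namespace codeSet

variable {S S' : Set ℕ}

/-- The left end of the `k`-th component. -/
def left (S : Set ℕ) (k : ℕ) : codeSet S :=
  ⟨k + 2, mem_codeSet.mpr ⟨k, le_rfl, le_codeEnd S k⟩⟩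

/-- The right end of the `k`-th component. -/
noncomputable def right (S : Set ℕ) (k : ℕ) : codeSet S :=
  ⟨codeEnd S k, mem_codeSet.mpr ⟨k, le_codeEnd S k, le_rfl⟩⟩

lemma left_eq_right_iff {k : ℕ} : left S k = right S k ↔ k ∉ S := by
  rw [← codeEnd_eq_iff, Subtype.ext_iff, eq_comm]
  rfl

lemma left_zero_le (x : codeSet S) : left S 0 ≤ x := by
  rw [← Subtype.coe_le_coe]
  simpa [left] using x.2.1

lemma right_covBy (k : ℕ) : right S k ⋖ left S (k + 1) := by
  constructor
  · rw [← Subtype.coe_lt_coe]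
    have := codeEnd_lt S k
    simp only [right, left, Nat.cast_add, Nat.cast_one]
    linarith
  · rintro x h1 h2
    rw [← Subtype.coe_lt_coe] at h1 h2
    simp only [right, left, Nat.cast_add, Nat.cast_one] at h1 h2
    rcases x.2.2 k with h | h <;> linarith

lemma exists_eq_right {x y : codeSet S} (h : x ⋖ y) : ∃ k, x = right S k := by
  obtain ⟨k, h1, h2⟩ := mem_codeSet.mp x.2
  refine ⟨k, Subtype.ext (le_antisymm h2 (not_lt.mp fun hlt => ?_))⟩
  have hxy : (x : ℝ) < y := h.1
  rcases le_or_gt (y : ℝ) (codeEnd S k) with hy | hy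
  · exact h.2 (c := ⟨(x + y) / 2, mem_codeSet.mpr ⟨k, by linarith, by linarith⟩⟩)
      (Subtype.coe_lt_coe.mp (by dsimp only; linarith))
      (Subtype.coe_lt_coe.mp (by dsimp only; linarith))
  · exact h.2 (c := right S k) (Subtype.coe_lt_coe.mp hlt) (Subtype.coe_lt_coe.mp hy)

lemma right_le {k : ℕ} {x y : codeSet S} (h : x ⋖ y) (hk : left S k ≤ x) : right S k ≤ x := by
  obtain ⟨j, rfl⟩ := exists_eq_right h
  rw [← Subtype.coe_le_coe] at hk ⊢
  simp only [left, right] at hk ⊢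
  have h1 : (k : ℝ) < j + 1 := by linarith [codeEnd_lt S j]
  have h2 : k ≤ j := Nat.lt_succ_iff.mp (by exact_mod_cast h1)
  rcases h2.eq_or_lt with rfl | h2
  · exact le_rfl
  · have : (k : ℝ) + 1 ≤ j := by exact_mod_cast h2
    linarith [codeEnd_lt S k, le_codeEnd S j]

lemma map_right_le (f : codeSet S ≃o codeSet S') {k : ℕ} (h : f (left S k) = left S' k) :
    right S' k ≤ f (right S k) :=
  right_le ((apply_covBy_apply_iff f).mpr (right_covBy k))
    (h ▸ f.monotone (Subtype.coe_le_coe.mp (le_codeEnd S k)))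

lemma map_right (f : codeSet S ≃o codeSet S') {k : ℕ} (h : f (left S k) = left S' k) :
    f (right S k) = right S' k := by
  refine le_antisymm ?_ (map_right_le f h)
  rw [← f.le_symm_apply]
  exact map_right_le f.symm (by rw [← h, f.symm_apply_apply])

lemma map_left (f : codeSet S ≃o codeSet S') (k : ℕ) : f (left S k) = left S' k := by
  induction k with
  | zero =>
    refine le_antisymm ?_ (left_zero_le _)
    rw [← f.le_symm_apply]
    exact left_zero_le _
  | succ k ih =>
    have h := (apply_covBy_apply_iff f).mpr (right_covBy (S := S) k)
    rw [map_right f ih] at h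
    exact h.unique_right (right_covBy k)

/-- The set `S` is determined by the order type of `codeSet S`. -/
lemma eq_of_orderIso (f : codeSet S ≃o codeSet S') : S = S' := by
  ext k
  rw [← not_iff_not, ← left_eq_right_iff, ← left_eq_right_iff, ← map_left f, ← map_right f
    (map_left f k), f.injective.eq_iff]

/-- A dense sequence in `codeSet S`. -/
noncomputable def seq (S : Set ℕ) : ℕ → codeSet S :=
  haveI : Nonempty (codeSet S) := ⟨left S 0⟩
  TopologicalSpace.denseSeq (codeSet S)

lemma denseRange_seq (S : Set ℕ) : DenseRange (seq S) :=
  haveI : Nonempty (codeSet S) := ⟨left S 0⟩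
  TopologicalSpace.denseRange_denseSeq (codeSet S)

lemma pos (x : codeSet S) : (0 : ℝ) < x := two_pos.trans_le x.2.1

/-- The folding data whose folds accumulate at the inverses of the elements of `codeSet S`. -/
noncomputable def foldData (S : Set ℕ) : FoldData where
  pos z := (seq S (Nat.unpair (⌊1 / z⌋₊ - 1)).1 : ℝ)⁻¹
  pos_pos _ := inv_pos.mpr (pos _)
  pos_le _ := (inv_anti₀ two_pos (seq S _).2.1).trans_eq (one_div 2).symm

lemma foldData_pos (n : ℕ) :
    (foldData S).pos (1 / ((n : ℝ) + 1)) = (seq S (Nat.unpair n).1 : ℝ)⁻¹ := by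
  have : ⌊1 / (1 / ((n : ℝ) + 1))⌋₊ = n + 1 := by
    rw [one_div_one_div]
    exact_mod_cast Nat.floor_natCast (R := ℝ) (n + 1)
  simp only [foldData, this, Nat.add_sub_cancel]

lemma inv_mem_limitSet {x : ℝ} (hx : x ∈ codeSet S) : x⁻¹ ∈ (foldData S).limitSet := by
  refine ⟨inv_pos.mpr (pos ⟨x, hx⟩), fun ε hε N => ?_⟩
  obtain ⟨i, hi⟩ := (denseRange_seq S).exists_dist_lt ⟨x, hx⟩ hε
  refine ⟨Nat.pair i N, Nat.right_le_pair i N, ?_⟩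
  rw [foldData_pos, Nat.unpair_pair]
  rw [Subtype.dist_eq, Real.dist_eq, abs_lt] at hi
  have h1 := (seq S i).2.1
  have h2 := hx.1
  have h3 : (seq S i : ℝ)⁻¹ - x⁻¹ = (x - seq S i) * ((seq S i : ℝ)⁻¹ * x⁻¹) := by
    field_simp
  have h4 : (seq S i : ℝ)⁻¹ * x⁻¹ ≤ 1 :=
    mul_le_one₀ (inv_le_one_of_one_le₀ (by linarith)) (by positivity)
      (inv_le_one_of_one_le₀ (by linarith))
  have h5 : 0 ≤ (seq S i : ℝ)⁻¹ * x⁻¹ := by positivity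
  rw [h3, abs_mul, abs_of_nonneg h5]
  refine lt_of_le_of_lt (mul_le_of_le_one_right (abs_nonneg _) h4) (abs_lt.mpr hi)

lemma inv_mem_codeSet {r : ℝ} (hr : r ∈ (foldData S).limitSet) : r⁻¹ ∈ codeSet S := by
  have hmem : r ∈ closure ((fun x : ℝ => x⁻¹) '' codeSet S) := by
    refine Metric.mem_closure_iff.mpr fun ε hε => ?_
    obtain ⟨n, -, hn⟩ := hr.2 ε hε 0
    rw [foldData_pos] at hn
    exact ⟨_, mem_image_of_mem _ (seq S _).2, by rwa [dist_comm, Real.dist_eq]⟩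
  have hc : r⁻¹ ∈ closure ((fun x : ℝ => x⁻¹) '' ((fun x : ℝ => x⁻¹) '' codeSet S)) :=
    mem_closure_image (continuousAt_inv₀ hr.1.ne') hmem
  rw [image_image] at hc
  simpa [(isClosed_codeSet S).closure_eq] using hc

/-- The limit set consists of the inverses of the elements of `codeSet S`. -/
noncomputable def limitSetIso (S : Set ℕ) : (foldData S).limitSet ≃o (codeSet S)ᵒᵈ where
  toFun r := OrderDual.toDual ⟨_, inv_mem_codeSet r.2⟩
  invFun x := ⟨_, inv_mem_limitSet (OrderDual.ofDual x).2⟩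
  left_inv _ := Subtype.ext (inv_inv _)
  right_inv _ := Subtype.ext (inv_inv _)
  map_rel_iff' {r r'} := inv_le_inv₀ r'.2.1 r.2.1

lemma eq_of_homeomorph (Φ : (foldData S).Space ≃ₜ (foldData S').Space) : S = S' := by
  obtain ⟨f⟩ := FoldData.exists_orderIso Φ
  exact eq_of_orderIso (((limitSetIso S).symm.trans f).trans (limitSetIso S')).dual

end codeSet

theorem not_countable_set_nat : ¬ Countable (Set ℕ) := fun _ => by
  obtain ⟨f, hf⟩ := exists_surjective_nat (Set ℕ)
  exact Function.cantor_surjective f hf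

/-- There is an uncountable family of pairwise non-homeomorphic Lelek-like fans, each
admitting a topologically mixing homeomorphism. -/
theorem statement1 :
    ∃ (Λ : Type) (X : Λ → Type) (m : ∀ l : Λ, MetricSpace (X l))
      (f : ∀ l : Λ, X l → X l),
      ¬ Countable Λ ∧
      (∀ l : Λ, letI := m l
        IsLelekLikeFan (X l) ∧ IsHomeomorph (f l) ∧ TopologicallyMixing (f l)) ∧
      (∀ l₁ l₂ : Λ, l₁ ≠ l₂ →
        letI := m l₁; letI := m l₂
        IsEmpty ((X l₁) ≃ₜ (X l₂))) := by
  refine ⟨Set ℕ, fun S => (codeSet.foldData S).Space,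
    fun S => TopologicalSpace.metrizableSpaceMetric _, fun S => (codeSet.foldData S).map 1,
    not_countable_set_nat, fun S => ⟨?_, ?_, ?_⟩, fun S S' hne => ⟨fun Φ => hne ?_⟩⟩
  · exact (codeSet.foldData S).isLelekLikeFan
  · exact (codeSet.foldData S).isHomeomorph_map 1
  · exact (codeSet.foldData S).mixing_map
  · exact codeSet.eq_of_homeomorph Φ
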